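/- arXiv:2002.02396 — 2 statements merged into one kernel-verified Lean document; each statement's English description precedes it below -/
import Mathlib

section
/- Assume MA(ω₁). Then there is no wide Aronszajn tree T such that every wide Aronszajn tree weakly embeds into T; that is, the class of wide Aronszajn trees has no universal element under weak embeddings. -/
universe u

open Cardinal Ordinal Set Classical

noncomputable def omega1 : Ordinal.{u} := (Cardinal.aleph 1).ord

/-- A tree: a partial order in which the set of strict predecessors of each element
is well-ordered by `<`. -/
def IsTree (T : Type u) [PartialOrder T] : Prop :=
  ∀ x : T, IsWellOrder {y : T // y < x} (fun a b => (a : T) < (b : T))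

/-- The height of an element of a tree: the order type of its set of strict predecessors. -/
noncomputable def treeHeight {T : Type u} [PartialOrder T] (x : T) : Ordinal.{u} :=
  if h : IsWellOrder {y : T // y < x} (fun a b => (a : T) < (b : T)) then
    @Ordinal.type _ _ h else 0

/-- The tree has height `ω₁`: every level below `ω₁` is nonempty and the level `ω₁` is empty
(equivalently, all heights are `< ω₁`). -/
def HasHeightOmega1 (T : Type u) [PartialOrder T] : Prop :=
  (∀ α : Ordinal.{u}, α < omega1.{u} → ∃ x : T, treeHeight x = α) ∧
    ∀ x : T, treeHeight x < omega1.{u}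

def NoUncountableChain (T : Type u) [PartialOrder T] : Prop :=
  ∀ C : Set T, IsChain (· < ·) C → C.Countable

def IsWideAronszajn (T : Type u) [PartialOrder T] : Prop :=
  IsTree T ∧ Cardinal.mk T = Cardinal.aleph.{u} 1 ∧ HasHeightOmega1 T ∧ NoUncountableChain T

def IsAronszajn (T : Type u) [PartialOrder T] : Prop :=
  IsTree T ∧ HasHeightOmega1 T ∧
    (∀ α : Ordinal.{u}, {x : T | treeHeight x = α}.Countable) ∧ NoUncountableChain T

def IsWeakEmbedding {T₁ T₂ : Type u} [PartialOrder T₁] [PartialOrder T₂] (f : T₁ → T₂) : Prop :=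
  ∀ x y : T₁, x < y → f x < f y

/-- Martin's axiom for ℵ₁ many dense sets. -/
def MAomega1 : Prop :=
  ∀ (P : Type u) [PartialOrder P], Nonempty P →
    (∀ A : Set P, (A.Pairwise fun p q => ¬ ∃ r, p ≤ r ∧ q ≤ r) → A.Countable) →
    ∀ 𝒟 : Set (Set P), Cardinal.mk 𝒟 ≤ Cardinal.aleph.{u} 1 →
      (∀ D ∈ 𝒟, ∀ p : P, ∃ q ∈ D, p ≤ q) →
      ∃ G : Set P, (∀ p ∈ G, ∀ q ∈ G, ∃ r ∈ G, p ≤ r ∧ q ≤ r) ∧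
        (∀ p ∈ G, ∀ q, q ≤ p → q ∈ G) ∧ ∀ D ∈ 𝒟, (G ∩ D).Nonempty

/-- A bundled partially ordered type. -/
structure PoType : Type (u + 1) where
  carrier : Type u
  str : PartialOrder carrier

attribute [instance] PoType.str

/-! ### Uncountable families indexed by `ω₁` -/

theorem exists_uncountable_fiber {ι σ : Type*} [Countable σ] {E : Set ι} (hE : ¬ E.Countable)
    (f : ι → σ) : ∃ a, ¬ (E ∩ {i | f i = a}).Countable := by
  by_contra! H
  refine hE ((Set.countable_iUnion H).mono fun i hi => ?_)
  exact Set.mem_iUnion.2 ⟨f i, hi, rfl⟩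

section Combinatorics

variable {O : Type*} [LinearOrder O]

theorem exists_const_or_countable_below (hO : ∀ a : O, (Iio a).Countable) {ι : Type*}
    {E : Set ι} (hE : ¬ E.Countable) (w : ι → O) :
    ∃ E' ⊆ E, ¬ E'.Countable ∧
      ((∃ a, ∀ i ∈ E', w i = a) ∨ ∀ γ, (E' ∩ {i | w i < γ}).Countable) := by
  by_cases H : ∃ a, ¬ (E ∩ {i | w i = a}).Countable
  · obtain ⟨a, ha⟩ := H
    exact ⟨_, inter_subset_left, ha, Or.inl ⟨a, fun i hi => hi.2⟩⟩
  · push Not at H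
    refine ⟨E, subset_rfl, hE, Or.inr fun γ => ?_⟩
    refine ((hO γ).biUnion fun a _ => H a).mono fun i hi => ?_
    exact Set.mem_biUnion (x := w i) hi.2 ⟨hi.1, rfl⟩

theorem exists_forall_const_or_countable_below (hO : ∀ a : O, (Iio a).Countable) {ι K : Type*}
    [Finite K] {E : Set ι} (hE : ¬ E.Countable) (w : ι → K → O) :
    ∃ E' ⊆ E, ¬ E'.Countable ∧
      ∀ k, (∃ a, ∀ i ∈ E', w i k = a) ∨ ∀ γ, (E' ∩ {i | w i k < γ}).Countable := by
  have := Fintype.ofFinite K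
  suffices ∀ s : Finset K, ∃ E' ⊆ E, ¬ E'.Countable ∧
      ∀ k ∈ s, (∃ a, ∀ i ∈ E', w i k = a) ∨ ∀ γ, (E' ∩ {i | w i k < γ}).Countable by
    obtain ⟨E', h1, h2, h3⟩ := this Finset.univ
    exact ⟨E', h1, h2, fun k => h3 k (Finset.mem_univ k)⟩
  intro s
  induction s using Finset.induction_on with
  | empty => exact ⟨E, subset_rfl, hE, by simp⟩
  | insert k s _ ih =>
    obtain ⟨E₁, h1, h2, h3⟩ := ih
    obtain ⟨E₂, h4, h5, h6⟩ := exists_const_or_countable_below hO h2 (fun i => w i k)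
    refine ⟨E₂, h4.trans h1, h5, fun l hl => ?_⟩
    rcases Finset.mem_insert.1 hl with rfl | hl
    · exact h6
    · rcases h3 l hl with ⟨a, ha⟩ | h
      · exact Or.inl ⟨a, fun i hi => ha i (h4 hi)⟩
      · exact Or.inr fun γ => (h γ).mono (inter_subset_inter_left _ h4)

theorem countable_Iic (hO : ∀ a : O, (Iio a).Countable) (a : O) : (Iic a).Countable := by
  rw [← Iio_insert]
  exact (hO a).insert a

theorem exists_forall_lt (hO : ∀ a : O, (Iio a).Countable) [Uncountable O]
    {s : Set O} (hs : s.Countable) : ∃ b, ∀ a ∈ s, a < b := by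
  by_contra! H
  refine Set.not_countable_univ (α := O) ?_
  refine (hs.biUnion fun a _ => countable_Iic hO a).mono fun b _ => ?_
  obtain ⟨a, ha, hba⟩ := H b
  exact Set.mem_biUnion ha hba

/-- Thinning out: after reindexing, every coordinate is either constant or tends to infinity. -/
theorem exists_reindex (hO : ∀ a : O, (Iio a).Countable) [Uncountable O] {K : Type*} [Finite K]
    {E : Set O} (hE : ¬ E.Countable) (w : O → K → O) :
    ∃ g : O → O, (∀ γ, g γ ∈ E) ∧ (∀ γ, γ ≤ g γ) ∧ ∃ i₀, ∀ k,
      (∃ a < i₀, ∀ γ, w (g γ) k = a) ∨ ∀ γ, γ ≤ w (g γ) k := by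
  obtain ⟨E', hE'E, hE', hw⟩ := exists_forall_const_or_countable_below hO hE w
  have hg : ∀ γ, ∃ i ∈ E', γ ≤ i ∧
      ∀ k, (∀ γ, (E' ∩ {i | w i k < γ}).Countable) → γ ≤ w i k := by
    intro γ
    by_contra! H
    refine hE' (((hO γ).union (Set.countable_iUnion fun k : K => Set.countable_iUnion
      fun h : ∀ γ, (E' ∩ {i | w i k < γ}).Countable => h γ)).mono fun i hi => ?_)
    rcases lt_or_ge i γ with h | h
    · exact Or.inl h
    · obtain ⟨k, hk, hlt⟩ := H i hi h
      exact Or.inr (Set.mem_iUnion.2 ⟨k, Set.mem_iUnion.2 ⟨hk, hi, hlt⟩⟩)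
  choose g hgE hle hgw using hg
  obtain ⟨x⟩ : Nonempty O := inferInstance
  obtain ⟨i₀, hi₀⟩ := exists_forall_lt hO (Set.countable_range (w (g x)))
  refine ⟨g, fun γ => hE'E (hgE γ), hle, i₀, fun k => ?_⟩
  rcases hw k with ⟨a, ha⟩ | h
  · exact Or.inl ⟨a, ha _ (hgE x) ▸ hi₀ _ ⟨k, rfl⟩, fun γ => ha _ (hgE γ)⟩
  · exact Or.inr fun γ => hgw γ k h

/-! ### Level functions on trees -/

/-- `h` assigns to the elements of the tree `T` their levels. -/
structure IsLevel {T : Type*} [PartialOrder T] (h : T → O) : Prop where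
  strictMono : StrictMono h
  exists_le : ∀ (t : T) (ξ : O), ξ ≤ h t → ∃ u ≤ t, h u = ξ
  total : ∀ t u v : T, u ≤ t → v ≤ t → u ≤ v ∨ v ≤ u

/-- The predecessor of `t` at level `ξ` (and `t` if there is none). -/
noncomputable def truncate {T : Type*} [PartialOrder T] (h : T → O) (t : T) (ξ : O) : T :=
  if H : ∃ u ≤ t, h u = ξ then H.choose else t

section Level

variable {T : Type*} [PartialOrder T] {h : T → O}

theorem IsLevel.le_of_le (hh : IsLevel h) {t u v : T} (hu : u ≤ t) (hv : v ≤ t)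
    (huv : h u ≤ h v) : u ≤ v := by
  rcases hh.total t u v hu hv with H | H
  · exact H
  · rcases H.lt_or_eq with H | H
    · exact absurd (hh.strictMono H) huv.not_gt
    · exact H.ge

theorem IsLevel.truncate_le (hh : IsLevel h) {t : T} {ξ : O} (hξ : ξ ≤ h t) :
    truncate h t ξ ≤ t := by
  have H := hh.exists_le t ξ hξ
  rw [truncate, dif_pos H]
  exact H.choose_spec.1

theorem IsLevel.level_truncate (hh : IsLevel h) {t : T} {ξ : O} (hξ : ξ ≤ h t) :
    h (truncate h t ξ) = ξ := by
  have H := hh.exists_le t ξ hξ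
  rw [truncate, dif_pos H]
  exact H.choose_spec.2

theorem IsLevel.truncate_eq (hh : IsLevel h) {t u : T} (hu : u ≤ t) : truncate h t (h u) = u := by
  have hξ : h u ≤ h t := hh.strictMono.monotone hu
  have h1 := hh.truncate_le hξ
  have h2 := hh.level_truncate hξ
  exact le_antisymm (hh.le_of_le h1 hu h2.le) (hh.le_of_le hu h1 h2.ge)

/-- In a tree without uncountable chains, an uncountable family of finite sets has two members
that are incomparable above a given level. -/
theorem IsLevel.exists_truncate_ne (hh : IsLevel h) (hO : ∀ a : O, (Iio a).Countable)
    [Uncountable O] (hT : NoUncountableChain T) {m : ℕ} (t : O → Fin m → T) (i₀ : O) (J : O → O) :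
    ∃ i j, i₀ ≤ i ∧ J i < j ∧ ∀ s s', i ≤ h (t i s) → j ≤ h (t j s') →
      truncate h (t i s) i ≠ truncate h (t j s') i := by
  by_contra! H
  have hno : NoMaxOrder O := ⟨fun a => by
    obtain ⟨b, hb⟩ := exists_forall_lt hO (Set.countable_singleton a)
    exact ⟨b, hb a rfl⟩⟩
  let U : Ultrafilter O := Ultrafilter.of Filter.atTop
  have hU : (U : Filter O) ≤ Filter.atTop := Ultrafilter.of_le _
  have h1 : ∀ i, ∃ s s', i₀ ≤ i → i ≤ h (t i s) ∧
      ∀ᶠ j in (U : Filter O), i ≤ h (t j s') ∧ truncate h (t i s) i = truncate h (t j s') i := by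
    intro i
    by_cases hi : i₀ ≤ i
    · have : ∀ᶠ j in (U : Filter O), ∃ x : Fin m × Fin m, i ≤ h (t i x.1) ∧
          (i ≤ h (t j x.2) ∧ truncate h (t i x.1) i = truncate h (t j x.2) i) := by
        refine hU ?_
        filter_upwards [Filter.eventually_gt_atTop (J i), Filter.eventually_gt_atTop i]
          with j hj hij
        obtain ⟨s, s', h1, h2, h3⟩ := H i j hi hj
        exact ⟨(s, s'), h1, hij.le.trans h2, h3⟩
      obtain ⟨x, hx⟩ := Ultrafilter.eventually_exists_iff.1 this
      exact ⟨x.1, x.2, fun _ => ⟨hx.exists.choose_spec.1, hx.mono fun j hj => hj.2⟩⟩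
    · obtain ⟨j, hj⟩ := exists_gt (J i₀)
      obtain ⟨s, s', -⟩ := H i₀ j le_rfl hj
      exact ⟨s, s', fun h => absurd h hi⟩
  choose s s' hs using h1
  have hE : ¬ (Ici i₀).Countable := fun hc => Set.not_countable_univ (α := O) <| by
    rw [← Iio_union_Ici (a := i₀)]
    exact (hO i₀).union hc
  obtain ⟨⟨a, b⟩, hab⟩ := exists_uncountable_fiber hE (fun i => (s i, s' i))
  set E := Ici i₀ ∩ {i | (s i, s' i) = (a, b)} with hEdef
  have hmem : ∀ i ∈ E, i ≤ h (t i a) ∧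
      ∀ᶠ j in (U : Filter O), i ≤ h (t j b) ∧ truncate h (t i a) i = truncate h (t j b) i := by
    rintro i ⟨hi, hi'⟩
    obtain ⟨rfl, rfl⟩ := Prod.mk.inj hi'
    exact hs i hi
  have hinj : InjOn (fun i => truncate h (t i a) i) E := by
    intro i hi j hj hij
    rw [← hh.level_truncate (hmem i hi).1, ← hh.level_truncate (hmem j hj).1]
    exact congrArg h hij
  refine hab (Set.countable_of_injective_of_countable_image hinj (hT _ ?_))
  rintro _ ⟨i, hi, rfl⟩ _ ⟨j, hj, rfl⟩ hne
  obtain ⟨k, ⟨hk1, hk2⟩, hk3, hk4⟩ := ((hmem i hi).2.and (hmem j hj).2).exists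
  have e1 := hh.truncate_le hk1
  have e2 := hh.truncate_le hk3
  simp only at hne ⊢
  rw [hk2, hk4] at hne ⊢
  rcases hh.total _ _ _ e1 e2 with H | H
  · exact Or.inl (H.lt_of_ne hne)
  · exact Or.inr (H.lt_of_ne hne.symm)

end Level

/-! ### The forcing -/

/-- On the levels of the nodes in `B`, the function `Δ` describes at which level the branches of a
tree indexed by the levels separate, `d` colours the nodes of these branches so that comparable
nodes get different colours, and `c` is a colouring of `B` which witnesses that the tree given by
`Δ` does not embed into `T`. -/
structure IsGood {T : Type*} [PartialOrder T] (h : T → O) (B : Set T) (c : T → ℕ)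
    (Δ : O → O → O) (d : O → O → ℕ) : Prop where
  self : ∀ x ∈ h '' B, Δ x x = x
  symm : ∀ x ∈ h '' B, ∀ y ∈ h '' B, Δ x y = Δ y x
  le : ∀ x ∈ h '' B, ∀ y ∈ h '' B, Δ x y ≤ x
  ultra : ∀ x ∈ h '' B, ∀ y ∈ h '' B, ∀ z ∈ h '' B, min (Δ x y) (Δ y z) ≤ Δ x z
  ne : ∀ s ∈ B, ∀ t ∈ B, c s = c t → h s ≠ h t →
    truncate h s (Δ (h s) (h t)) ≠ truncate h t (Δ (h s) (h t))
  le_of_eq : ∀ x ∈ h '' B, ∀ ξ ∈ h '' B, ∀ y ∈ h '' B, ∀ η ∈ h '' B, ξ < η →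
    d x ξ = d y η → Δ x y ≤ ξ

/-- Finite approximations to a function `Δ` and colourings `c`, `d` as in `IsGood`. -/
structure Approx {T : Type*} [PartialOrder T] (h : T → O) where
  nodes : Finset T
  c : T → ℕ
  Δ : O → O → O
  d : O → O → ℕ
  good : IsGood h nodes c Δ d

instance {T : Type*} [PartialOrder T] (h : T → O) : Preorder (Approx h) where
  le p q := p.nodes ⊆ q.nodes ∧ (∀ t ∈ p.nodes, q.c t = p.c t) ∧
    ∀ x ∈ h '' p.nodes, ∀ y ∈ h '' p.nodes, q.Δ x y = p.Δ x y ∧ q.d x y = p.d x y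
  le_refl p := ⟨subset_rfl, fun _ _ => rfl, fun _ _ _ _ => ⟨rfl, rfl⟩⟩
  le_trans p q r hpq hqr := by
    refine ⟨hpq.1.trans hqr.1, fun t ht => ?_, fun x hx y hy => ?_⟩
    · rw [hqr.2.1 t (hpq.1 ht), hpq.2.1 t ht]
    · have hsub : h '' p.nodes ⊆ h '' q.nodes := image_mono (by exact_mod_cast hpq.1)
      have h1 := hqr.2.2 x (hsub hx) y (hsub hy)
      have h2 := hpq.2.2 x hx y hy
      exact ⟨h1.1.trans h2.1, h1.2.trans h2.2⟩

/-- Colours of pairs taken from a finite set that are pairwise different and different from the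
colours in another given finite set. -/
theorem exists_fresh {O : Type*} {F : Set O} (hF : F.Finite) {N : Set ℕ} (hN : N.Finite) :
    ∃ e : O → O → ℕ, (∀ x y, e x y ∉ N) ∧
      ∀ x ∈ F, ∀ y ∈ F, ∀ x' ∈ F, ∀ y' ∈ F, e x y = e x' y' → x = x' ∧ y = y' := by
  obtain ⟨M, hM⟩ := hN.bddAbove
  obtain ⟨ε, hε⟩ := Set.countable_iff_exists_injOn.1 hF.countable
  refine ⟨fun x y => M + 1 + Nat.pair (ε x) (ε y), fun x y hxy => ?_,
    fun x hx y hy x' hx' y' hy' H => ?_⟩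
  · have : M + 1 + Nat.pair (ε x) (ε y) ≤ M := hM hxy
    omega
  · have := Nat.pair_eq_pair.1 (Nat.add_left_cancel H)
    exact ⟨hε hx hx' this.1, hε hy hy' this.2⟩

theorem Approx.exists_mem {T : Type*} [PartialOrder T] {h : T → O} {b : O} (hb : ∀ x, b ≤ x)
    (p : Approx h) (a : T) : ∃ q, p ≤ q ∧ a ∈ q.nodes := by
  by_cases ha : a ∈ p.nodes
  · exact ⟨p, le_rfl, ha⟩
  have hfin : (h '' (insert a p.nodes : Finset T)).Finite := (Finset.finite_toSet _).image h
  have hfin' : (h '' p.nodes).Finite := (Finset.finite_toSet _).image h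
  obtain ⟨C, hC⟩ := (p.nodes.finite_toSet.image p.c).bddAbove
  obtain ⟨e, he, he'⟩ := exists_fresh hfin (N := (fun z : O × O => p.d z.1 z.2) ''
    ((h '' p.nodes) ×ˢ (h '' p.nodes))) ((hfin'.prod hfin').image _)
  have heN : ∀ x y, ∀ x' ∈ h '' p.nodes, ∀ y' ∈ h '' p.nodes, e x y ≠ p.d x' y' :=
    fun x y x' hx' y' hy' H => he x y ⟨(x', y'), ⟨hx', hy'⟩, H.symm⟩
  set F : Set O := h '' p.nodes with hF
  have hFi : h '' (insert a p.nodes : Finset T) = insert (h a) F := by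
    rw [Finset.coe_insert, image_insert_eq]
  have hself := p.good.self
  have hsymm := p.good.symm
  have hle := p.good.le
  have hultra := p.good.ultra
  have hco := p.good.le_of_eq
  rw [← hF] at hself hsymm hle hultra hco
  obtain ⟨D, hDF, hDself, hDne⟩ : ∃ D : O → O → O, (∀ x ∈ F, ∀ y ∈ F, D x y = p.Δ x y) ∧
      (∀ x, D x x = x) ∧ ∀ x y, ¬ (x ∈ F ∧ y ∈ F) → x ≠ y → D x y = b := by
    refine ⟨fun x y => if x ∈ F ∧ y ∈ F then p.Δ x y else if x = y then x else b,
      fun x hx y hy => if_pos ⟨hx, hy⟩, fun x => ?_, fun x y hxy hne => ?_⟩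
    · by_cases hx : x ∈ F <;> simp [hx, hself]
    · dsimp only
      rw [if_neg hxy, if_neg hne]
  have hDle : ∀ x y, D x y ≤ x := by
    intro x y
    rcases eq_or_ne x y with rfl | hne
    · exact (hDself x).le
    by_cases hxy : x ∈ F ∧ y ∈ F
    · exact (hDF x hxy.1 y hxy.2).trans_le (hle x hxy.1 y hxy.2)
    · exact (hDne x y hxy hne).trans_le (hb x)
  refine ⟨⟨insert a p.nodes, fun t => if t = a then C + 1 else p.c t, D,
    fun x y => if x ∈ F ∧ y ∈ F then p.d x y else e x y, ?_⟩, ?_, ?_⟩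
  · rw [hFi] at he'
    constructor
    · exact fun x _ => hDself x
    · intro x _ y _
      rcases eq_or_ne x y with rfl | hne
      · rfl
      by_cases hxy : x ∈ F ∧ y ∈ F
      · rw [hDF x hxy.1 y hxy.2, hDF y hxy.2 x hxy.1, hsymm x hxy.1 y hxy.2]
      · rw [hDne x y hxy hne, hDne y x (fun H => hxy H.symm) hne.symm]
    · exact fun x _ y _ => hDle x y
    · intro x _ y _ z _
      rcases eq_or_ne x z with rfl | hxz
      · exact (min_le_left _ _).trans ((hDle x y).trans (hDself x).ge)
      rcases eq_or_ne x y with rfl | hxy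
      · exact min_le_right _ _
      rcases eq_or_ne y z with rfl | hyz
      · exact min_le_left _ _
      by_cases h1 : x ∈ F ∧ y ∈ F
      · by_cases h2 : y ∈ F ∧ z ∈ F
        · rw [hDF x h1.1 y h1.2, hDF y h1.2 z h2.2, hDF x h1.1 z h2.2]
          exact hultra x h1.1 y h1.2 z h2.2
        · exact (min_le_right _ _).trans ((hDne y z h2 hyz).trans_le (hb _))
      · exact (min_le_left _ _).trans ((hDne x y h1 hxy).trans_le (hb _))
    · intro s hs t ht hst hne
      have hs' : s = a ∨ s ∈ p.nodes := by simpa using hs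
      have ht' : t = a ∨ t ∈ p.nodes := by simpa using ht
      have hlt : ∀ u ∈ p.nodes, p.c u < C + 1 := fun u hu =>
        Nat.lt_succ_of_le (hC ⟨u, hu, rfl⟩)
      by_cases h1 : s = a <;> by_cases h2 : t = a
      · exact absurd (h1.trans h2.symm ▸ rfl) hne
      · simp only [h1, h2, if_true, if_false] at hst
        have := hlt t (ht'.resolve_left h2)
        omega
      · simp only [h1, h2, if_true, if_false] at hst
        have := hlt s (hs'.resolve_left h1)
        omega
      · simp only [h1, h2, if_false] at hst
        have hs := hs'.resolve_left h1
        have ht := ht'.resolve_left h2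
        rw [hDF _ ⟨s, hs, rfl⟩ _ ⟨t, ht, rfl⟩]
        exact p.good.ne s hs t ht hst hne
    · rw [hFi]
      intro x hx ξ hξ y hy η hη hlt heq
      by_cases h1 : x ∈ F ∧ ξ ∈ F <;> by_cases h2 : y ∈ F ∧ η ∈ F
      · rw [if_pos h1, if_pos h2] at heq
        rw [hDF x h1.1 y h2.1]
        exact hco x h1.1 ξ h1.2 y h2.1 η h2.2 hlt heq
      · rw [if_pos h1, if_neg h2] at heq
        exact absurd heq.symm (heN _ _ _ h1.1 _ h1.2)
      · rw [if_neg h1, if_pos h2] at heq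
        exact absurd heq (heN _ _ _ h2.1 _ h2.2)
      · rw [if_neg h1, if_neg h2] at heq
        exact absurd (he' x hx ξ hξ y hy η hη heq).2 hlt.ne
  · refine ⟨Finset.subset_insert _ _, fun t ht => ?_, fun x hx y hy => ?_⟩
    · exact if_neg fun H : t = a => ha (H ▸ ht)
    · exact ⟨hDF x hx y hy, if_pos ⟨hx, hy⟩⟩
  · exact Finset.mem_insert_self _ _

/-- Either `x` and `x'` coincide and lie below `i`, or they lie in the consecutive intervals
`[i, j)` and `[j, ∞)`. -/
def Separated (i j x x' : O) : Prop :=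
  (x = x' ∧ x < i) ∨ (i ≤ x ∧ x < j ∧ j ≤ x')

theorem Separated.eq_of_lt {i j x x' : O} (H : Separated i j x x') (hx : x < i) : x = x' := by
  rcases H with H | H
  · exact H.1
  · exact absurd hx H.1.not_gt

theorem Separated.eq_of_lt' {i j x x' : O} (H : Separated i j x x') (hx : x' < j) : x = x' := by
  rcases H with H | H
  · exact H.1
  · exact absurd hx H.2.2.not_gt

theorem Separated.lt {i j x x' : O} (H : Separated i j x x') (hij : i < j) : x < j := by
  rcases H with H | H
  · exact H.2.trans hij
  · exact H.2.1

theorem Separated.lt_of_eq {i j x x' : O} (H : Separated i j x x') (hx : x = x') : x < i := by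
  rcases H with H | H
  · exact H.2
  · exact absurd (hx ▸ H.2.1) H.2.2.not_gt

theorem Separated.min_eq {i j x x' : O} (H : Separated i j x x') (hij : i < j) :
    min i x = min i x' := by
  rcases H with H | H
  · rw [H.1]
  · rw [min_eq_left H.1, min_eq_left (hij.le.trans H.2.2)]

/-- Two isomorphic approximations whose entries are separated by `i` and `j` are compatible if their
nodes are incomparable at level `i`. Here `φ` maps the levels of `p` and `q` to those of `p`; the
common levels are the ones below `i`, and values of `Δ` above `i` occur on one side only. -/
theorem Approx.exists_upper_bound {T : Type*} [PartialOrder T] {h : T → O} (p q : Approx h)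
    {code : T → O} (hcode : Function.Injective code) {i j : O} (hij : i < j) {m : ℕ}
    {t t' : Fin m → T} (hp : ∀ x, x ∈ p.nodes ↔ ∃ s, t s = x)
    (hq : ∀ x, x ∈ q.nodes ↔ ∃ s, t' s = x) (ht : Function.Injective t)
    (hlev : ∀ s, Separated i j (h (t s)) (h (t' s)))
    (hnode : ∀ s, Separated i j (code (t s)) (code (t' s)))
    (hΔ : ∀ s s', Separated i j (p.Δ (h (t s)) (h (t s'))) (q.Δ (h (t' s)) (h (t' s'))))
    (htr : ∀ r s s', Separated i j (code (truncate h (t r) (p.Δ (h (t s)) (h (t s')))))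
      (code (truncate h (t' r) (q.Δ (h (t' s)) (h (t' s'))))))
    (hc : ∀ s, p.c (t s) = q.c (t' s))
    (hd : ∀ s s', p.d (h (t s)) (h (t s')) = q.d (h (t' s)) (h (t' s')))
    (heq : ∀ s s', h (t s) = h (t s') ↔ h (t' s) = h (t' s'))
    (hne : ∀ s s', i ≤ h (t s) → j ≤ h (t' s') → truncate h (t s) i ≠ truncate h (t' s') i) :
    ∃ r, p ≤ r ∧ q ≤ r := by
  have hF : ∀ x, x ∈ h '' p.nodes ↔ ∃ s, h (t s) = x := by
    intro x
    constructor
    · rintro ⟨y, hy, rfl⟩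
      obtain ⟨s, rfl⟩ := (hp y).1 hy
      exact ⟨s, rfl⟩
    · rintro ⟨s, rfl⟩
      exact ⟨t s, (hp _).2 ⟨s, rfl⟩, rfl⟩
  have hF' : ∀ x, x ∈ h '' q.nodes ↔ ∃ s, h (t' s) = x := by
    intro x
    constructor
    · rintro ⟨y, hy, rfl⟩
      obtain ⟨s, rfl⟩ := (hq y).1 hy
      exact ⟨s, rfl⟩
    · rintro ⟨s, rfl⟩
      exact ⟨t' s, (hq _).2 ⟨s, rfl⟩, rfl⟩
  have hfin : (h '' p.nodes ∪ h '' q.nodes).Finite :=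
    ((Finset.finite_toSet _).image h).union ((Finset.finite_toSet _).image h)
  have hfin' : (h '' p.nodes).Finite := (Finset.finite_toSet _).image h
  obtain ⟨e, he, he'⟩ := exists_fresh hfin (N := (fun z : O × O => p.d z.1 z.2) ''
    ((h '' p.nodes) ×ˢ (h '' p.nodes))) ((hfin'.prod hfin').image _)
  have hpself := p.good.self
  have hpsymm := p.good.symm
  have hple := p.good.le
  have hpultra := p.good.ultra
  have hpco := p.good.le_of_eq
  have hqself := q.good.self
  have hqsymm := q.good.symm
  have hqle := q.good.le
  have hqultra := q.good.ultra
  have hqco := q.good.le_of_eq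
  set F : Set O := h '' p.nodes
  set F' : Set O := h '' q.nodes
  have hsF : ∀ s, h (t s) ∈ F := fun s => (hF _).2 ⟨s, rfl⟩
  have hsF' : ∀ s, h (t' s) ∈ F' := fun s => (hF' _).2 ⟨s, rfl⟩
  have heN : ∀ x y, ∀ x' ∈ F, ∀ y' ∈ F, e x y ≠ p.d x' y' :=
    fun x y x' hx' y' hy' H => he x y ⟨(x', y'), ⟨hx', hy'⟩, H.symm⟩
  have heN' : ∀ x y, ∀ x' ∈ F', ∀ y' ∈ F', e x y ≠ q.d x' y' := by
    intro x y x' hx' y' hy'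
    obtain ⟨s, rfl⟩ := (hF' _).1 hx'
    obtain ⟨s', rfl⟩ := (hF' _).1 hy'
    rw [← hd]
    exact heN _ _ _ (hsF s) _ (hsF s')
  have hroot : ∀ s s', h (t s) = h (t' s') → h (t s) = h (t' s) ∧ h (t' s) = h (t' s') := by
    intro s s' H
    have h1 : h (t s') = h (t' s') := (hlev s').eq_of_lt' (H ▸ (hlev s).lt hij)
    have h2 : h (t' s) = h (t' s') := (heq s s').1 (H.trans h1.symm)
    exact ⟨H.trans h2.symm, h2⟩
  have hrootlt : ∀ x ∈ F, x ∈ F' → x < i := by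
    intro x hx hx'
    obtain ⟨s, rfl⟩ := (hF _).1 hx
    obtain ⟨s', hs'⟩ := (hF' _).1 hx'
    exact (hlev s).lt_of_eq (hroot s s' hs'.symm).1
  obtain ⟨φ, hφ, hφ'⟩ : ∃ φ : O → O, (∀ s, φ (h (t s)) = h (t s)) ∧
      ∀ s, φ (h (t' s)) = h (t s) := by
    refine ⟨fun x => if x ∈ F then x else if H : ∃ s, h (t' s) = x then h (t H.choose) else x,
      fun s => if_pos (hsF s), fun s => ?_⟩
    by_cases hs : h (t' s) ∈ F
    · dsimp only
      rw [if_pos hs]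
      obtain ⟨s', hs'⟩ := (hF _).1 hs
      have h1 := hroot _ _ hs'
      rw [← h1.2, ← h1.1]
      exact (heq _ _).2 h1.2
    · have H : ∃ s', h (t' s') = h (t' s) := ⟨s, rfl⟩
      dsimp only
      rw [if_neg hs, dif_pos H]
      exact (heq _ _).2 H.choose_spec
  have hφF : ∀ x, x ∈ F ∪ F' → φ x ∈ F := by
    rintro x (hx | hx)
    · obtain ⟨s, rfl⟩ := (hF _).1 hx
      rw [hφ]
      exact hsF s
    · obtain ⟨s, rfl⟩ := (hF' _).1 hx
      rw [hφ']
      exact hsF s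
  have hagree : ∀ x ∈ F, x ∈ F' → ∀ y ∈ F, y ∈ F' → p.Δ x y = q.Δ x y := by
    intro x hx hx' y hy hy'
    have hlt := (hple x hx y hy).trans_lt (hrootlt x hx hx')
    obtain ⟨r, hr⟩ := (hF' _).1 hx'
    obtain ⟨s, rfl⟩ := (hF _).1 hx
    obtain ⟨r', hr'⟩ := (hF' _).1 hy'
    obtain ⟨s', rfl⟩ := (hF _).1 hy
    rw [(hΔ s s').eq_of_lt hlt, ← (hroot _ _ hr.symm).1, ← (hroot _ _ hr'.symm).1]
  have hagreed : ∀ x ∈ F, x ∈ F' → ∀ y ∈ F, y ∈ F' → p.d x y = q.d x y := by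
    intro x hx hx' y hy hy'
    obtain ⟨r, hr⟩ := (hF' _).1 hx'
    obtain ⟨s, rfl⟩ := (hF _).1 hx
    obtain ⟨r', hr'⟩ := (hF' _).1 hy'
    obtain ⟨s', rfl⟩ := (hF _).1 hy
    rw [hd s s', ← (hroot _ _ hr.symm).1, ← (hroot _ _ hr'.symm).1]
  obtain ⟨D, hDF, hDF', hDmix⟩ : ∃ D : O → O → O, (∀ x ∈ F, ∀ y ∈ F, D x y = p.Δ x y) ∧
      (∀ x ∈ F', ∀ y ∈ F', D x y = q.Δ x y) ∧
      ∀ x y, ¬ (x ∈ F ∧ y ∈ F) → ¬ (x ∈ F' ∧ y ∈ F') → D x y = min i (p.Δ (φ x) (φ y)) := by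
    refine ⟨fun x y => if x ∈ F ∧ y ∈ F then p.Δ x y else if x ∈ F' ∧ y ∈ F' then q.Δ x y else
      min i (p.Δ (φ x) (φ y)), fun x hx y hy => if_pos ⟨hx, hy⟩, fun x hx y hy => ?_,
      fun x y h1 h2 => ?_⟩ <;> dsimp only
    · by_cases H : x ∈ F ∧ y ∈ F
      · rw [if_pos H]
        exact hagree x H.1 hx y H.2 hy
      · rw [if_neg H, if_pos ⟨hx, hy⟩]
    · rw [if_neg h1, if_neg h2]
  have hDmin : ∀ x ∈ F ∪ F', ∀ y ∈ F ∪ F', min i (D x y) = min i (p.Δ (φ x) (φ y)) := by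
    intro x hx y hy
    by_cases h1 : x ∈ F ∧ y ∈ F
    · rw [hDF x h1.1 y h1.2]
      obtain ⟨s, rfl⟩ := (hF _).1 h1.1
      obtain ⟨s', rfl⟩ := (hF _).1 h1.2
      rw [hφ, hφ]
    by_cases h2 : x ∈ F' ∧ y ∈ F'
    · rw [hDF' x h2.1 y h2.2]
      obtain ⟨s, rfl⟩ := (hF' _).1 h2.1
      obtain ⟨s', rfl⟩ := (hF' _).1 h2.2
      rw [hφ', hφ', (hΔ s s').min_eq hij]
    · rw [hDmix x y h1 h2, ← min_assoc, min_self]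
  have hDsymm : ∀ x ∈ F ∪ F', ∀ y ∈ F ∪ F', D x y = D y x := by
    intro x hx y hy
    by_cases h1 : x ∈ F ∧ y ∈ F
    · rw [hDF x h1.1 y h1.2, hDF y h1.2 x h1.1, hpsymm x h1.1 y h1.2]
    by_cases h2 : x ∈ F' ∧ y ∈ F'
    · rw [hDF' x h2.1 y h2.2, hDF' y h2.2 x h2.1, hqsymm x h2.1 y h2.2]
    · rw [hDmix x y h1 h2, hDmix y x (fun H => h1 H.symm) (fun H => h2 H.symm),
        hpsymm _ (hφF x hx) _ (hφF y hy)]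
  have hφle : ∀ x ∈ F ∪ F', min i (φ x) ≤ x := by
    rintro x (hx | hx)
    · obtain ⟨s, rfl⟩ := (hF _).1 hx
      rw [hφ]
      exact min_le_right _ _
    · obtain ⟨s, rfl⟩ := (hF' _).1 hx
      rw [hφ', (hlev s).min_eq hij]
      exact min_le_right _ _
  have hDle : ∀ x ∈ F ∪ F', ∀ y ∈ F ∪ F', D x y ≤ x := by
    intro x hx y hy
    by_cases h1 : x ∈ F ∧ y ∈ F
    · exact (hDF x h1.1 y h1.2).trans_le (hple x h1.1 y h1.2)
    by_cases h2 : x ∈ F' ∧ y ∈ F'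
    · exact (hDF' x h2.1 y h2.2).trans_le (hqle x h2.1 y h2.2)
    · rw [hDmix x y h1 h2]
      exact (min_le_min_left i (hple _ (hφF x hx) _ (hφF y hy))).trans (hφle x hx)
  have hDlt : ∀ x ∈ F ∪ F', ∀ y ∈ F ∪ F', i < D x y →
      (x ∈ F ∧ y ∈ F ∧ x ∉ F' ∧ y ∉ F') ∨ (x ∈ F' ∧ y ∈ F' ∧ x ∉ F ∧ y ∉ F) := by
    intro x hx y hy H
    have hxi : i < x := H.trans_le (hDle x hx y hy)
    have hyi : i < y := H.trans_le ((hDsymm x hx y hy).trans_le (hDle y hy x hx))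
    by_cases h1 : x ∈ F ∧ y ∈ F
    · exact Or.inl ⟨h1.1, h1.2, fun h => (hrootlt x h1.1 h).not_gt hxi,
        fun h => (hrootlt y h1.2 h).not_gt hyi⟩
    by_cases h2 : x ∈ F' ∧ y ∈ F'
    · exact Or.inr ⟨h2.1, h2.2, fun h => (hrootlt x h h2.1).not_gt hxi,
        fun h => (hrootlt y h h2.2).not_gt hyi⟩
    · rw [hDmix x y h1 h2] at H
      exact absurd H (min_le_left _ _).not_gt
  have hDcross : ∀ x ∈ F, ∀ y ∈ F', D x y ≤ i := by
    intro x hx y hy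
    by_contra! H
    rcases hDlt x (Or.inl hx) y (Or.inr hy) H with h | h
    · exact h.2.2.2 hy
    · exact h.2.2.1 hx
  have hDeq : ∀ s s', D (h (t s)) (h (t' s')) < i →
      p.Δ (h (t s)) (h (t s')) = D (h (t s)) (h (t' s')) := by
    intro s s' H
    have h1 := hDmin _ (Or.inl (hsF s)) _ (Or.inr (hsF' s'))
    rw [hφ, hφ', min_eq_right H.le] at h1
    rcases le_total i (p.Δ (h (t s)) (h (t s'))) with h2 | h2
    · rw [min_eq_left h2] at h1
      exact absurd h1 H.ne
    · rw [h1, min_eq_right h2]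
  have hDne : ∀ s s', p.c (t s) = q.c (t' s') → h (t s) ≠ h (t' s') →
      truncate h (t s) (D (h (t s)) (h (t' s'))) ≠
        truncate h (t' s') (D (h (t s)) (h (t' s'))) := by
    intro s s' hcol hss
    rcases (hDcross _ (hsF s) _ (hsF' s')).lt_or_eq with H | H
    · have h1 := hDeq s s' H
      have h2 : q.Δ (h (t' s)) (h (t' s')) = D (h (t s)) (h (t' s')) := by
        rw [← (hΔ s s').eq_of_lt (h1 ▸ H), h1]
      by_cases hs : h (t s) = h (t s')
      · rw [← hs, hpself _ (hsF s)] at h1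
        have h3 := (hlev s).eq_of_lt (h1 ▸ H)
        exact absurd (h3.trans ((heq s s').1 hs)) hss
      · have h3 := p.good.ne _ ((hp _).2 ⟨s, rfl⟩) _ ((hp _).2 ⟨s', rfl⟩)
          (hcol.trans (hc s').symm) hs
        intro h4
        have h5 := htr s' s s'
        rw [h1, h2, ← h4] at h5
        have h6 := (htr s s s').lt hij
        rw [h1] at h6
        rw [h1] at h3
        exact h3 (hcode (h5.eq_of_lt' h6)).symm
    · rw [H]
      have h1 : i ≤ h (t s) := H.symm.trans_le (hDle _ (Or.inl (hsF s)) _ (Or.inr (hsF' s')))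
      have h2 : i ≤ h (t' s') := by
        rw [hDsymm _ (Or.inl (hsF s)) _ (Or.inr (hsF' s'))] at H
        exact H.symm.trans_le (hDle _ (Or.inr (hsF' s')) _ (Or.inl (hsF s)))
      refine hne s s' h1 ?_
      rcases hlev s' with h3 | h3
      · exact absurd (h3.1 ▸ h3.2) h2.not_gt
      · exact h3.2.2
  have hcagree : ∀ x ∈ p.nodes, x ∈ q.nodes → p.c x = q.c x := by
    intro x hx hx'
    obtain ⟨s, rfl⟩ := (hp x).1 hx
    obtain ⟨s', hs'⟩ := (hq _).1 hx'
    have h1 : t s' = t' s' :=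
      hcode ((hnode s').eq_of_lt' (by rw [hs']; exact (hnode s).lt hij))
    obtain rfl := ht (h1.trans hs')
    rw [hc, hs']
  obtain ⟨c, hcp, hcq⟩ : ∃ c : T → ℕ, (∀ x ∈ p.nodes, c x = p.c x) ∧
      ∀ x ∈ q.nodes, c x = q.c x := by
    refine ⟨fun x => if x ∈ p.nodes then p.c x else q.c x, fun x hx => if_pos hx,
      fun x hx => ?_⟩
    by_cases H : x ∈ p.nodes
    · exact (if_pos H).trans (hcagree x H hx)
    · exact if_neg H
  obtain ⟨d, hdF, hdF', hdmix⟩ : ∃ d : O → O → ℕ, (∀ x ∈ F, ∀ y ∈ F, d x y = p.d x y) ∧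
      (∀ x ∈ F', ∀ y ∈ F', d x y = q.d x y) ∧
      ∀ x y, ¬ (x ∈ F ∧ y ∈ F) → ¬ (x ∈ F' ∧ y ∈ F') → d x y = e x y := by
    refine ⟨fun x y => if x ∈ F ∧ y ∈ F then p.d x y else if x ∈ F' ∧ y ∈ F' then q.d x y else
      e x y, fun x hx y hy => if_pos ⟨hx, hy⟩, fun x hx y hy => ?_,
      fun x y h1 h2 => ?_⟩ <;> dsimp only
    · by_cases H : x ∈ F ∧ y ∈ F
      · rw [if_pos H]
        exact hagreed x H.1 hx y H.2 hy
      · rw [if_neg H, if_pos ⟨hx, hy⟩]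
    · rw [if_neg h1, if_neg h2]
  have hdold : ∀ x ξ, ((x ∈ F ∧ ξ ∈ F) ∨ (x ∈ F' ∧ ξ ∈ F')) → ∀ y η, d x ξ ≠ e y η := by
    rintro x ξ (⟨hx, hξ⟩ | ⟨hx, hξ⟩) y η H
    · exact heN _ _ _ hx _ hξ (H.symm.trans (hdF _ hx _ hξ))
    · exact heN' _ _ _ hx _ hξ (H.symm.trans (hdF' _ hx _ hξ))
  have himage : h '' ((p.nodes ∪ q.nodes : Finset T) : Set T) = F ∪ F' := by
    rw [Finset.coe_union, image_union]
  refine ⟨⟨p.nodes ∪ q.nodes, c, D, d, ?_⟩, ?_, ?_⟩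
  · constructor <;> (try rw [himage]) <;> try assumption
    · rintro x (hx | hx)
      · rw [hDF x hx x hx, hpself x hx]
      · rw [hDF' x hx x hx, hqself x hx]
    · intro x hx y hy z hz
      rcases le_or_gt (min (D x y) (D y z)) i with H | H
      · have h1 := hpultra _ (hφF x hx) _ (hφF y hy) _ (hφF z hz)
        have h2 : min i (min (D x y) (D y z)) ≤ min i (D x z) := by
          have hmin : ∀ a b c : O, min a (min b c) = min (min a b) (min a c) :=
            fun a b c => inf_inf_distrib_left a b c
          rw [hDmin x hx z hz, hmin, hDmin x hx y hy, hDmin y hy z hz,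
            ← hmin]
          exact min_le_min_left i h1
        rw [min_eq_right H] at h2
        exact h2.trans (min_le_right _ _)
      · obtain ⟨h1, h2⟩ := lt_min_iff.1 H
        rcases hDlt x hx y hy h1 with ⟨a1, a2, a3, a4⟩ | ⟨a1, a2, a3, a4⟩ <;>
          rcases hDlt y hy z hz h2 with ⟨b1, b2, b3, b4⟩ | ⟨b1, b2, b3, b4⟩
        · rw [hDF x a1 y a2, hDF y a2 z b2, hDF x a1 z b2]
          exact hpultra x a1 y a2 z b2
        · exact absurd b1 a4
        · exact absurd a2 b3
        · rw [hDF' x a1 y a2, hDF' y a2 z b2, hDF' x a1 z b2]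
          exact hqultra x a1 y a2 z b2
    · intro x hx y hy hcxy hxy
      rw [Finset.coe_union] at hx hy
      rcases hx with hx | hx <;> rcases hy with hy | hy
      · rw [hDF _ ⟨x, hx, rfl⟩ _ ⟨y, hy, rfl⟩]
        exact p.good.ne x hx y hy (by rw [← hcp x hx, ← hcp y hy, hcxy]) hxy
      · rw [hcp x hx, hcq y hy] at hcxy
        obtain ⟨s, rfl⟩ := (hp _).1 hx
        obtain ⟨s', rfl⟩ := (hq _).1 hy
        exact hDne s s' hcxy hxy
      · rw [hcq x hx, hcp y hy] at hcxy
        rw [hDsymm _ (Or.inr ⟨x, hx, rfl⟩) _ (Or.inl ⟨y, hy, rfl⟩)]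
        obtain ⟨s, rfl⟩ := (hp _).1 hy
        obtain ⟨s', rfl⟩ := (hq _).1 hx
        exact (hDne s s' hcxy.symm hxy.symm).symm
      · rw [hDF' _ ⟨x, hx, rfl⟩ _ ⟨y, hy, rfl⟩]
        exact q.good.ne x hx y hy (by rw [← hcq x hx, ← hcq y hy, hcxy]) hxy
    · intro x hx ξ hξ y hy η hη hlt hxy
      by_cases h1 : (x ∈ F ∧ ξ ∈ F) ∨ (x ∈ F' ∧ ξ ∈ F')
      swap
      · push Not at h1
        have h1e := hdmix x ξ (fun H => h1.1 H.1 H.2) (fun H => h1.2 H.1 H.2)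
        by_cases h2 : (y ∈ F ∧ η ∈ F) ∨ (y ∈ F' ∧ η ∈ F')
        · exact absurd (hxy.symm.trans h1e) (hdold y η h2 x ξ)
        · push Not at h2
          have h2e := hdmix y η (fun H => h2.1 H.1 H.2) (fun H => h2.2 H.1 H.2)
          exact absurd (he' x hx ξ hξ y hy η hη (by rw [← h1e, ← h2e, hxy])).2 hlt.ne
      by_cases h2 : (y ∈ F ∧ η ∈ F) ∨ (y ∈ F' ∧ η ∈ F')
      swap
      · push Not at h2
        have h2e := hdmix y η (fun H => h2.1 H.1 H.2) (fun H => h2.2 H.1 H.2)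
        exact absurd (hxy.trans h2e) (hdold x ξ h1 y η)
      rcases h1 with ⟨h1, h3⟩ | ⟨h1, h3⟩ <;> rcases h2 with ⟨h2, h4⟩ | ⟨h2, h4⟩
      · rw [hDF x h1 y h2]
        rw [hdF x h1 ξ h3, hdF y h2 η h4] at hxy
        exact hpco x h1 ξ h3 y h2 η h4 hlt hxy
      · by_contra! H
        rw [hdF x h1 ξ h3, hdF' y h2 η h4] at hxy
        have hDi := hDcross x h1 y h2
        have hξi := H.trans_le hDi
        obtain ⟨k, rfl⟩ := (hF _).1 h1
        obtain ⟨l, rfl⟩ := (hF _).1 h3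
        obtain ⟨k', rfl⟩ := (hF' _).1 h2
        have h5 := (hlev l).eq_of_lt hξi
        rw [hd] at hxy
        rw [h5] at hlt H
        have h6 := hqco _ (hsF' k) _ (hsF' l) _ h2 _ h4 hlt hxy
        have h7 := hDmin _ hx _ hy
        rw [hφ, hφ', (hΔ k k').min_eq hij, min_eq_right hDi] at h7
        exact (h7.trans_le (min_le_right _ _)).not_gt (h6.trans_lt H)
      · by_contra! H
        rw [hdF' x h1 ξ h3, hdF y h2 η h4] at hxy
        have hDi := (hDsymm x hx y hy).trans_le (hDcross y h2 x h1)
        have hξi := H.trans_le hDi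
        obtain ⟨k, rfl⟩ := (hF' _).1 h1
        obtain ⟨l, rfl⟩ := (hF' _).1 h3
        obtain ⟨k', rfl⟩ := (hF _).1 h2
        have h5 := (hlev l).eq_of_lt' (hξi.trans hij)
        rw [← hd] at hxy
        rw [← h5] at hlt H
        have h6 := hpco _ (hsF k) _ (hsF l) _ h2 _ h4 hlt hxy
        have h7 := hDmin _ hx _ hy
        rw [hφ, hφ', min_eq_right hDi] at h7
        exact (h7.trans_le (min_le_right _ _)).not_gt (h6.trans_lt H)
      · rw [hDF' x h1 y h2]
        rw [hdF' x h1 ξ h3, hdF' y h2 η h4] at hxy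
        exact hqco x h1 ξ h3 y h2 η h4 hlt hxy
  · exact ⟨Finset.subset_union_left, hcp, fun x hx y hy => ⟨hDF x hx y hy, hdF x hx y hy⟩⟩
  · exact ⟨Finset.subset_union_right, hcq, fun x hx y hy => ⟨hDF' x hx y hy, hdF' x hx y hy⟩⟩

/-- The finite approximations satisfy the countable chain condition. -/
theorem Approx.exists_ne_upper_bound (hO : ∀ a : O, (Iio a).Countable) [Uncountable O]
    {T : Type*} [PartialOrder T] {h : T → O} (hh : IsLevel h) (hT : NoUncountableChain T)
    {code : T → O} (hcode : Function.Injective code) (p : O → Approx h) :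
    ∃ i j, i ≠ j ∧ ∃ r, p i ≤ r ∧ p j ≤ r := by
  obtain ⟨m, hm⟩ := exists_uncountable_fiber (Set.not_countable_univ (α := O))
    (fun i => (p i).nodes.card)
  rw [univ_inter] at hm
  have henum : ∀ i, (p i).nodes.card = m → ∃ τ : Fin m → T, Function.Injective τ ∧
      ∀ x, x ∈ (p i).nodes ↔ ∃ s, τ s = x := by
    intro i hi
    let ε := (p i).nodes.equivFinOfCardEq hi
    refine ⟨fun s => ε.symm s, Subtype.val_injective.comp ε.symm.injective, fun x => ?_⟩
    refine ⟨fun hx => ⟨ε ⟨x, hx⟩, by simp⟩, ?_⟩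
    rintro ⟨s, rfl⟩
    exact (ε.symm s).2
  have htotal : ∀ i, ∃ τ : Fin m → T, (p i).nodes.card = m → Function.Injective τ ∧
      ∀ x, x ∈ (p i).nodes ↔ ∃ s, τ s = x := by
    intro i
    by_cases hi : (p i).nodes.card = m
    · obtain ⟨τ, hτ⟩ := henum i hi
      exact ⟨τ, fun _ => hτ⟩
    · obtain ⟨k, hk⟩ : {i | (p i).nodes.card = m}.Nonempty := by
        by_contra! H
        exact hm (H ▸ Set.countable_empty)
      exact ⟨(henum k hk).choose, fun H => absurd H hi⟩
  choose t ht using htotal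
  obtain ⟨⟨c, d, ρ⟩, hE⟩ := exists_uncountable_fiber hm
    (fun i => ((fun s => (p i).c (t i s), fun s s' => (p i).d (h (t i s)) (h (t i s')),
      fun s s' => h (t i s) = h (t i s')) :
      (Fin m → ℕ) × (Fin m → Fin m → ℕ) × (Fin m → Fin m → Prop)))
  let w : O → Fin m ⊕ Fin m ⊕ (Fin m × Fin m) ⊕ (Fin m × Fin m × Fin m) → O := fun i =>
    Sum.elim (fun s => h (t i s)) (Sum.elim (fun s => code (t i s))
      (Sum.elim (fun x => (p i).Δ (h (t i x.1)) (h (t i x.2)))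
        (fun x => code (truncate h (t i x.1) ((p i).Δ (h (t i x.2.1)) (h (t i x.2.2)))))))
  obtain ⟨g, hgE, hg, i₀, hw⟩ := exists_reindex hO hE w
  have hJ : ∀ i, ∃ b, ∀ a ∈ insert i (insert (g i) (range (w (g i)))), a < b := fun i =>
    exists_forall_lt hO (((Set.countable_range _).insert _).insert _)
  choose J hJ using hJ
  have hsep : ∀ i j, i₀ ≤ i → J i < j → ∀ k, Separated i j (w (g i) k) (w (g j) k) := by
    intro i j hi hj k
    rcases hw k with ⟨a, ha, hk⟩ | hk
    · exact Or.inl ⟨(hk i).trans (hk j).symm, (hk i).trans_lt (ha.trans_le hi)⟩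
    · refine Or.inr ⟨hk i, (hJ i _ ?_).trans hj, hk j⟩
      exact Or.inr (Or.inr ⟨k, rfl⟩)
  obtain ⟨i, j, hi, hj, hne⟩ := hh.exists_truncate_ne hO hT (fun i => t (g i)) i₀ J
  have hij : i < j := (hJ i i (Or.inl rfl)).trans hj
  have hgij : g i < g j := ((hJ i _ (Or.inr (Or.inl rfl))).trans hj).trans_le (hg j)
  have hshape := (hgE i).2.trans (hgE j).2.symm
  simp only [Prod.mk.injEq] at hshape
  have hs := hsep i j hi hj
  exact ⟨g i, g j, hgij.ne, (p (g i)).exists_upper_bound (p (g j)) hcode hij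
    (ht _ (hgE i).1).2 (ht _ (hgE j).1).2 (ht _ (hgE i).1).1
    (fun s => hs (Sum.inl s)) (fun s => hs (Sum.inr (Sum.inl s)))
    (fun s s' => hs (Sum.inr (Sum.inr (Sum.inl (s, s')))))
    (fun r s s' => hs (Sum.inr (Sum.inr (Sum.inr (r, s, s')))))
    (fun s => congrFun hshape.1 s) (fun s s' => congrFun (congrFun hshape.2.1 s) s')
    (fun s s' => iff_of_eq (congrFun (congrFun hshape.2.2 s) s')) hne⟩

end Combinatorics

/-! ### Applying Martin's axiom -/

/-- Martin's axiom for preorders. -/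
theorem MAomega1.exists_generic (hMA : MAomega1.{u}) {O T P : Type u} [Preorder P] [Nonempty P]
    (hO : #O = ℵ₁) (hT : #T ≤ ℵ₁) (hP : ∀ p : O → P, ∃ i j, i ≠ j ∧ ∃ r, p i ≤ r ∧ p j ≤ r)
    (D : T → Set P) (hD : ∀ t p, ∃ q ∈ D t, p ≤ q) :
    ∃ G : Set P, (∀ p ∈ G, ∀ q ∈ G, ∃ r ∈ G, p ≤ r ∧ q ≤ r) ∧ ∀ t, (G ∩ D t).Nonempty := by
  have hccc : ∀ A : Set (Antisymmetrization P (· ≤ ·)),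
      (A.Pairwise fun p q => ¬ ∃ r, p ≤ r ∧ q ≤ r) → A.Countable := by
    intro A hA
    by_contra hAc
    have : #O ≤ #A := by
      rw [hO, ← succ_aleph0, Order.succ_le_iff]
      by_contra! H
      exact hAc (Cardinal.le_aleph0_iff_set_countable.1 H)
    obtain ⟨ε⟩ := this
    obtain ⟨i, j, hij, r, h1, h2⟩ := hP fun i => ofAntisymmetrization (· ≤ ·) (ε i).1
    refine hA (ε i).2 (ε j).2 (fun H => hij (ε.injective (Subtype.ext H)))
      ⟨toAntisymmetrization (· ≤ ·) r, ?_, ?_⟩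
    · rw [← toAntisymmetrization_ofAntisymmetrization (· ≤ ·) (ε i).1]
      exact h1
    · rw [← toAntisymmetrization_ofAntisymmetrization (· ≤ ·) (ε j).1]
      exact h2
  have hdense : ∀ E ∈ range fun t => toAntisymmetrization (α := P) (· ≤ ·) '' D t, ∀ p,
      ∃ q ∈ E, p ≤ q := by
    rintro _ ⟨t, rfl⟩ p
    induction p using Quotient.inductionOn with | h p =>
    obtain ⟨q, hq, hpq⟩ := hD t p
    exact ⟨_, ⟨q, hq, rfl⟩, hpq⟩
  obtain ⟨G, hG, -, hGD⟩ := hMA (Antisymmetrization P (· ≤ ·))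
    (Nonempty.map (toAntisymmetrization (· ≤ ·)) inferInstance) hccc _
    (Cardinal.mk_range_le.trans hT) hdense
  refine ⟨toAntisymmetrization (· ≤ ·) ⁻¹' G, fun p hp q hq => ?_, fun t => ?_⟩
  · obtain ⟨r, hr, h1, h2⟩ := hG _ hp _ hq
    induction r using Quotient.inductionOn with | h r =>
    exact ⟨r, hr, h1, h2⟩
  · obtain ⟨_, hx, p, hp, rfl⟩ := hGD _ ⟨t, rfl⟩
    exact ⟨p, hx, hp⟩

theorem exists_isGood (hMA : MAomega1.{u}) {O T : Type u} [LinearOrder O] [PartialOrder T]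
    {b : O} (hb : ∀ x, b ≤ x) (hO : ∀ a : O, (Iio a).Countable) (hOc : #O = ℵ₁) (hTc : #T = ℵ₁)
    {h : T → O} (hh : IsLevel h) (hsurj : Function.Surjective h) (hT : NoUncountableChain T) :
    ∃ c Δ d, IsGood h univ c Δ d := by
  have : Uncountable O := by
    rw [← not_countable_iff, ← Cardinal.mk_le_aleph0_iff, hOc, not_le]
    exact aleph0_lt_aleph_one
  obtain ⟨code⟩ : Nonempty (T ↪ O) := (hTc.trans hOc.symm).le
  have : Nonempty (Approx h) :=
    ⟨⟨∅, fun _ => 0, fun _ _ => b, fun _ _ => 0, by constructor <;> simp⟩⟩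
  obtain ⟨G, hG, hGD⟩ := hMA.exists_generic hOc hTc.le
    (Approx.exists_ne_upper_bound hO hh hT code.injective)
    (fun t => {p : Approx h | t ∈ p.nodes}) (fun t p => by
      obtain ⟨q, h1, h2⟩ := p.exists_mem hb t
      exact ⟨q, h2, h1⟩)
  have hG' : ∀ s : Finset T, ∃ p ∈ G, s ⊆ p.nodes := by
    intro s
    induction s using Finset.induction_on with
    | empty =>
      obtain ⟨p, hp, -⟩ := hGD (hsurj b).choose
      exact ⟨p, hp, Finset.empty_subset _⟩
    | insert a s _ ih =>
      obtain ⟨p, hp, hsp⟩ := ih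
      obtain ⟨q, hq, haq⟩ := hGD a
      obtain ⟨r, hr, hpr, hqr⟩ := hG p hp q hq
      exact ⟨r, hr, Finset.insert_subset (hqr.1 haq) (hsp.trans hpr.1)⟩
  choose P hPG hP using hG'
  choose σ hσ using hsurj
  have hmem : ∀ s : Finset T, ∀ x, σ x ∈ s → x ∈ h '' (P s).nodes := fun s x hx =>
    ⟨σ x, hP s hx, hσ x⟩
  let c : T → ℕ := fun t => (P {t}).c t
  let Δ : O → O → O := fun x y => (P {σ x, σ y}).Δ x y
  let d : O → O → ℕ := fun x y => (P {σ x, σ y}).d x y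
  have hc : ∀ p ∈ G, ∀ t ∈ p.nodes, c t = p.c t := by
    intro p hp t ht
    obtain ⟨r, -, h1, h2⟩ := hG p hp _ (hPG {t})
    rw [← h1.2.1 t ht, h2.2.1 t (hP {t} (Finset.mem_singleton_self t))]
  have hΔd : ∀ p ∈ G, ∀ x ∈ h '' p.nodes, ∀ y ∈ h '' p.nodes,
      Δ x y = p.Δ x y ∧ d x y = p.d x y := by
    intro p hp x hx y hy
    obtain ⟨r, -, h1, h2⟩ := hG p hp _ (hPG {σ x, σ y})
    obtain ⟨e1, e2⟩ := h1.2.2 x hx y hy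
    obtain ⟨e3, e4⟩ := h2.2.2 x (hmem _ x (by simp)) y (hmem _ y (by simp))
    exact ⟨e3.symm.trans e1, e4.symm.trans e2⟩
  have hΔ := fun p hp x hx y hy => (hΔd p hp x hx y hy).1
  have hd := fun p hp x hx y hy => (hΔd p hp x hx y hy).2
  refine ⟨c, Δ, d, ?_, ?_, ?_, ?_, ?_, ?_⟩
  · intro x _
    have hx := hmem {σ x} x (by simp)
    rw [hΔ _ (hPG {σ x}) x hx x hx]
    exact (P {σ x}).good.self x hx
  · intro x _ y _
    have hx := hmem {σ x, σ y} x (by simp)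
    have hy := hmem {σ x, σ y} y (by simp)
    rw [hΔ _ (hPG _) x hx y hy, hΔ _ (hPG _) y hy x hx]
    exact (P _).good.symm x hx y hy
  · intro x _ y _
    have hx := hmem {σ x, σ y} x (by simp)
    have hy := hmem {σ x, σ y} y (by simp)
    exact (P _).good.le x hx y hy
  · intro x _ y _ z _
    have hx := hmem {σ x, σ y, σ z} x (by simp)
    have hy := hmem {σ x, σ y, σ z} y (by simp)
    have hz := hmem {σ x, σ y, σ z} z (by simp)
    rw [hΔ _ (hPG _) x hx y hy, hΔ _ (hPG _) y hy z hz, hΔ _ (hPG _) x hx z hz]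
    exact (P _).good.ultra x hx y hy z hz
  · intro s _ t _ hst hne
    have hs := hP {s, t} (show s ∈ _ by simp)
    have ht := hP {s, t} (show t ∈ _ by simp)
    rw [hc _ (hPG _) s hs, hc _ (hPG _) t ht] at hst
    rw [hΔ _ (hPG _) _ ⟨s, hs, rfl⟩ _ ⟨t, ht, rfl⟩]
    exact (P _).good.ne s hs t ht hst hne
  · intro x _ ξ _ y _ η _ hlt heq
    have hx := hmem {σ x, σ ξ, σ y, σ η} x (by simp)
    have hξ := hmem {σ x, σ ξ, σ y, σ η} ξ (by simp)
    have hy := hmem {σ x, σ ξ, σ y, σ η} y (by simp)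
    have hη := hmem {σ x, σ ξ, σ y, σ η} η (by simp)
    rw [hd _ (hPG _) x hx ξ hξ, hd _ (hPG _) y hy η hη] at heq
    rw [hΔ _ (hPG _) x hx y hy]
    exact (P _).good.le_of_eq x hx ξ hξ y hy η hη hlt heq

/-! ### Heights -/

theorem IsLevel.nonempty_relIso {O S : Type*} [LinearOrder O] [PartialOrder S] {ℓ : S → O}
    (hℓ : IsLevel ℓ) (s : S) :
    Nonempty ((fun a b : {y : S // y < s} => (a : S) < (b : S)) ≃r
      Subrel (· < · : O → O → Prop) (· < ℓ s)) := by
  let f : {y : S // y < s} → {a : O // a < ℓ s} := fun y => ⟨ℓ y, hℓ.strictMono y.2⟩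
  have hf : ∀ a b : {y : S // y < s}, ℓ a < ℓ b ↔ (a : S) < b := fun a b =>
    ⟨fun H => (hℓ.le_of_le a.2.le b.2.le H.le).lt_of_ne fun e => H.ne (congrArg ℓ e),
      fun H => hℓ.strictMono H⟩
  have hbij : Function.Bijective f := by
    refine ⟨fun a b hab => ?_, fun ⟨ξ, hξ⟩ => ?_⟩
    · have e : ℓ a = ℓ b := congrArg Subtype.val hab
      exact Subtype.ext (le_antisymm (hℓ.le_of_le a.2.le b.2.le e.le)
        (hℓ.le_of_le b.2.le a.2.le e.ge))
    · obtain ⟨u, hu, rfl⟩ := hℓ.exists_le s ξ hξ.le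
      exact ⟨⟨u, hu.lt_of_ne fun e => hξ.ne (congrArg ℓ e)⟩, rfl⟩
  exact ⟨⟨Equiv.ofBijective f hbij, fun {a b} => hf a b⟩⟩

theorem IsLevel.isTree {O S : Type u} [LinearOrder O] [WellFoundedLT O] [PartialOrder S]
    {ℓ : S → O} (hℓ : IsLevel ℓ) : IsTree S := fun s => by
  obtain ⟨e⟩ := hℓ.nonempty_relIso s
  exact e.toRelEmbedding.isWellOrder

theorem IsLevel.treeHeight_eq {O S : Type u} [LinearOrder O] [WellFoundedLT O] [PartialOrder S]
    {ℓ : S → O} (hℓ : IsLevel ℓ) (s : S) : treeHeight s = typein (α := O) (· < ·) (ℓ s) := by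
  obtain ⟨e⟩ := hℓ.nonempty_relIso s
  have := hℓ.isTree s
  rw [treeHeight, dif_pos this, ← type_subrel]
  exact e.ordinalType_congr

theorem IsTree.treeHeight_eq_type {T : Type u} [PartialOrder T] (hT : IsTree T) (t : T) :
    treeHeight t = @type _ (fun a b : {y : T // y < t} => (a : T) < (b : T)) (hT t) :=
  dif_pos (hT t)

theorem IsTree.treeHeight_eq_typein {T : Type u} [PartialOrder T] (hT : IsTree T) (t : T)
    (u : {y : T // y < t}) : treeHeight (u : T) =
      @typein _ (fun a b : {y : T // y < t} => (a : T) < (b : T)) (hT t) u := by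
  have := hT t
  have := hT u
  rw [hT.treeHeight_eq_type, ← type_subrel]
  refine RelIso.ordinalType_congr ⟨⟨fun y => ⟨⟨y, y.2.trans u.2⟩, y.2⟩, fun y => ⟨y.1, y.2⟩,
    fun _ => rfl, fun _ => rfl⟩, Iff.rfl⟩

theorem IsTree.total {T : Type u} [PartialOrder T] (hT : IsTree T) {t u v : T} (hu : u ≤ t)
    (hv : v ≤ t) : u ≤ v ∨ v ≤ u := by
  rcases hu.eq_or_lt with rfl | hu
  · exact Or.inr hv
  rcases hv.eq_or_lt with rfl | hv
  · exact Or.inl hu.le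
  have := hT t
  rcases trichotomous_of (fun a b : {y : T // y < t} => (a : T) < (b : T)) ⟨u, hu⟩ ⟨v, hv⟩
    with H | H | H
  · exact Or.inl H.le
  · exact Or.inl (congrArg Subtype.val H).le
  · exact Or.inr H.le

theorem IsTree.exists_isLevel {T : Type u} [PartialOrder T] (hT : IsTree T)
    (hh : HasHeightOmega1 T) :
    ∃ h : T → omega1.{u}.ToType, IsLevel h ∧ Function.Surjective h := by
  have hlt : ∀ t u : T, u < t → treeHeight u < treeHeight t := by
    intro t u hut
    rw [hT.treeHeight_eq_typein t ⟨u, hut⟩, hT.treeHeight_eq_type t]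
    exact @typein_lt_type _ _ (hT t) _
  refine ⟨fun t => ToType.mk ⟨treeHeight t, hh.2 t⟩, ⟨fun u t hut => ?_, fun t ξ hξ => ?_,
    fun t u v hu hv => hT.total hu hv⟩, fun ξ => ?_⟩
  · exact ToType.mk.lt_iff_lt.2 (hlt t u hut)
  · obtain ⟨⟨ξ, hξ1⟩, rfl⟩ := ToType.mk.surjective ξ
    rcases (show ξ ≤ treeHeight t from ToType.mk.le_iff_le.1 hξ).eq_or_lt with rfl | H
    · exact ⟨t, le_rfl, rfl⟩
    · rw [hT.treeHeight_eq_type t] at H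
      obtain ⟨u, rfl⟩ := @typein_surj _ _ (hT t) _ H
      exact ⟨u, u.2.le, by simp only [hT.treeHeight_eq_typein t u]⟩
  · obtain ⟨⟨ξ, hξ⟩, rfl⟩ := ToType.mk.surjective ξ
    obtain ⟨t, rfl⟩ := hh.1 ξ hξ
    exact ⟨t, rfl⟩

/-! ### The tree of branches separating according to `Δ` -/

/-- The node at level `level` on the branch with index `branch`. -/
structure BranchNode (O : Type*) [LE O] where
  branch : O
  level : O
  le : level ≤ branch

theorem exists_isLevel_of_ultra {O : Type u} [LinearOrder O] {Δ : O → O → O}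
    (hself : ∀ x, Δ x x = x) (hsymm : ∀ x y, Δ x y = Δ y x)
    (hultra : ∀ x y z, min (Δ x y) (Δ y z) ≤ Δ x z) :
    ∃ (S : Type u) (_ : PartialOrder S) (ℓ : S → O) (π : BranchNode O → S),
      IsLevel ℓ ∧ Function.Surjective π ∧ (∀ p, ℓ (π p) = p.level) ∧
        ∀ p q, π p ≤ π q ↔ p.level ≤ q.level ∧ p.level ≤ Δ p.branch q.branch := by
  let _ : Preorder (BranchNode O) :=
    { le := fun p q => p.level ≤ q.level ∧ p.level ≤ Δ p.branch q.branch
      le_refl := fun p => ⟨le_rfl, p.le.trans (hself _).ge⟩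
      le_trans := fun p q r hpq hqr => ⟨hpq.1.trans hqr.1,
        (le_min hpq.2 (hpq.1.trans hqr.2)).trans (hultra _ _ _)⟩ }
  let π : BranchNode O → Antisymmetrization _ (· ≤ ·) :=
    toAntisymmetrization (· ≤ ·)
  let ℓ : Antisymmetrization (BranchNode O) (· ≤ ·) → O :=
    fun s => (ofAntisymmetrization (· ≤ ·) s).level
  have hπ : Function.Surjective π := Quotient.mk_surjective
  have hle : ∀ p q, π p ≤ π q ↔ p.level ≤ q.level ∧ p.level ≤ Δ p.branch q.branch :=
    fun p q => Iff.rfl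
  have hℓ : ∀ p, ℓ (π p) = p.level := by
    intro p
    have h1 : π (ofAntisymmetrization (· ≤ ·) (π p)) = π p :=
      toAntisymmetrization_ofAntisymmetrization _ _
    exact le_antisymm ((hle _ _).1 h1.le).1 ((hle _ _).1 h1.ge).1
  refine ⟨_, inferInstance, ℓ, π, ⟨?_, ?_, ?_⟩, hπ, hℓ, hle⟩
  · intro a b hab
    obtain ⟨p, rfl⟩ := hπ a
    obtain ⟨q, rfl⟩ := hπ b
    rw [hℓ, hℓ]
    have h1 := (hle _ _).1 hab.le
    refine h1.1.lt_of_ne fun e => hab.not_ge ((hle _ _).2 ⟨e.ge, ?_⟩)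
    rw [hsymm, ← e]
    exact h1.2
  · intro t ξ hξ
    obtain ⟨p, rfl⟩ := hπ t
    rw [hℓ] at hξ
    exact ⟨π ⟨p.branch, ξ, hξ.trans p.le⟩, (hle _ _).2 ⟨hξ, (hξ.trans p.le).trans (hself _).ge⟩,
      hℓ _⟩
  · intro t u v hu hv
    obtain ⟨r, rfl⟩ := hπ t
    obtain ⟨p, rfl⟩ := hπ u
    obtain ⟨q, rfl⟩ := hπ v
    simp only [hle] at *
    have key := hultra p.branch r.branch q.branch
    rw [hsymm r.branch] at key
    rcases le_total p.level q.level with h | h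
    · exact Or.inl ⟨h, (le_min hu.2 (h.trans hv.2)).trans key⟩
    · rw [hsymm q.branch p.branch]
      exact Or.inr ⟨h, (le_min (h.trans hu.2) hv.2).trans key⟩

theorem IsLevel.injOn_of_isChain {O S : Type*} [LinearOrder O] [PartialOrder S] {ℓ : S → O}
    (hℓ : IsLevel ℓ) {C : Set S} (hC : IsChain (· < ·) C) : InjOn ℓ C := by
  intro a ha b hb hab
  by_contra hne
  rcases hC ha hb hne with H | H
  · exact (hℓ.strictMono H).ne hab
  · exact (hℓ.strictMono H).ne hab.symm

theorem IsLevel.noUncountableChain {O S : Type u} [LinearOrder O]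
    (hO : ∀ a : O, (Iio a).Countable) [Uncountable O] [PartialOrder S] {ℓ : S → O}
    (hℓ : IsLevel ℓ) {Δ : O → O → O} {d : O → O → ℕ} (hsymm : ∀ x y, Δ x y = Δ y x)
    (hd : ∀ x ξ y η, ξ < η → d x ξ = d y η → Δ x y ≤ ξ) {α : S → O}
    (hα : ∀ s t, s ≤ t → ℓ s ≤ Δ (α s) (α t)) : NoUncountableChain S := by
  intro C hC
  by_contra hcount
  have hunb : ∀ ξ, ∃ s ∈ C, ξ < ℓ s := by
    intro ξ
    by_contra! H
    refine hcount (Set.countable_of_injective_of_countable_image (hℓ.injOn_of_isChain hC)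
      ((countable_Iic hO ξ).mono ?_))
    rintro _ ⟨s, hs, rfl⟩
    exact H s hs
  choose s hsC hs using hunb
  have hne : ∀ ξ η, ξ < η → d (α (s ξ)) ξ ≠ d (α (s η)) η := by
    intro ξ η hlt heq
    have h1 := hd _ _ _ _ hlt heq
    have h2 : s ξ ≤ s η ∨ s η ≤ s ξ := by
      rcases eq_or_ne (s ξ) (s η) with H | H
      · exact Or.inl H.le
      · exact (hC (hsC ξ) (hsC η) H).imp le_of_lt le_of_lt
    rcases h2 with h2 | h2
    · exact ((hs ξ).trans_le (hα _ _ h2)).not_ge h1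
    · rw [hsymm] at h1
      exact ((hlt.trans (hs η)).trans_le (hα _ _ h2)).not_ge h1
  have hinj : Function.Injective fun ξ => d (α (s ξ)) ξ := by
    intro ξ η heq
    rcases lt_trichotomy ξ η with H | H | H
    · exact absurd heq (hne _ _ H)
    · exact H
    · exact absurd heq.symm (hne _ _ H)
  exact not_countable_iff.2 ‹Uncountable O› hinj.countable

theorem IsLevel.isWideAronszajn {S : Type u} [PartialOrder S] {ℓ : S → omega1.{u}.ToType}
    (hℓ : IsLevel ℓ) (hsurj : Function.Surjective ℓ) (hcard : #S ≤ ℵ₁)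
    (hchain : NoUncountableChain S) : IsWideAronszajn S := by
  refine ⟨hℓ.isTree, hcard.antisymm ?_, ⟨fun α hα => ?_, fun x => ?_⟩, hchain⟩
  · calc ℵ₁ = #omega1.{u}.ToType := (mk_ord_toType _).symm
      _ ≤ #S := mk_le_of_surjective hsurj
  · obtain ⟨s, hs⟩ := hsurj (ToType.mk ⟨α, hα⟩)
    refine ⟨s, ?_⟩
    rw [hℓ.treeHeight_eq, hs]
    exact typein_enum _ _
  · rw [hℓ.treeHeight_eq]
    exact typein_lt_self _

/-- Weak embeddings raise levels. -/
theorem IsWeakEmbedding.level_le {O S T : Type u} [LinearOrder O] [WellFoundedLT O]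
    [PartialOrder S] [PartialOrder T] {ℓ : S → O} {h : T → O} (hℓ : IsLevel ℓ) (hh : IsLevel h)
    {f : S → T} (hf : IsWeakEmbedding f) (s : S) : ℓ s ≤ h (f s) := by
  suffices ∀ ξ s, ℓ s = ξ → ξ ≤ h (f s) from this _ s rfl
  intro ξ
  induction ξ using WellFoundedLT.induction with
  | ind ξ ih =>
    rintro s rfl
    by_contra! H
    obtain ⟨u, hus, hu⟩ := hℓ.exists_le s _ H.le
    have hlt : u < s := hus.lt_of_ne fun e => H.ne (by rw [← hu, e])
    exact (hh.strictMono (hf u s hlt)).not_ge (ih _ H u hu)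

/-- The colouring `c` prevents weak embeddings of the tree given by `Δ`. -/
theorem IsGood.not_isWeakEmbedding {O S T : Type u} [LinearOrder O] [WellFoundedLT O]
    [Uncountable O] [PartialOrder S] [PartialOrder T] {ℓ : S → O} {h : T → O} (hℓ : IsLevel ℓ)
    (hh : IsLevel h) (hsurj : Function.Surjective h) {c : T → ℕ} {Δ : O → O → O} {d : O → O → ℕ}
    (hgood : IsGood h univ c Δ d) {π : BranchNode O → S}
    (hπℓ : ∀ p, ℓ (π p) = p.level)
    (hπ : ∀ p q, π p ≤ π q ↔ p.level ≤ q.level ∧ p.level ≤ Δ p.branch q.branch) (f : S → T) :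
    ¬ IsWeakEmbedding f := by
  intro hf
  have hx : ∀ x, x ∈ h '' univ := fun x => by rw [image_univ]; exact hsurj x
  have hmono : Monotone f := fun a b hab => hab.eq_or_lt.elim (fun e => e ▸ le_rfl)
    fun H => (hf a b H).le
  let top : O → S := fun α => π ⟨α, α, le_rfl⟩
  have htop : ∀ α, α ≤ h (f (top α)) := fun α =>
    (hπℓ ⟨α, α, le_rfl⟩).symm.trans_le (hf.level_le hℓ hh _)
  let g : O → T := fun α => truncate h (f (top α)) α
  have hg : ∀ α, h (g α) = α := fun α => hh.level_truncate (htop α)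
  have htr : ∀ α ξ (hξ : ξ ≤ α), truncate h (g α) ξ = truncate h (f (π ⟨α, ξ, hξ⟩)) ξ := by
    intro α ξ hξ
    have h1 : π ⟨α, ξ, hξ⟩ ≤ top α := (hπ _ _).2 ⟨hξ, hξ.trans (hgood.self α (hx α)).ge⟩
    have h2 : ξ ≤ h (f (π ⟨α, ξ, hξ⟩)) :=
      (hπℓ ⟨α, ξ, hξ⟩).symm.trans_le (hf.level_le hℓ hh _)
    have h3 := hh.level_truncate h2
    have h4 := hh.le_of_le ((hh.truncate_le h2).trans (hmono h1)) (hh.truncate_le (htop α))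
      (by rw [h3]; exact hξ.trans (hg α).ge)
    have h5 := hh.truncate_eq h4
    rwa [h3] at h5
  have hinj : Function.Injective fun α => c (g α) := by
    intro α β hαβ
    by_contra hne
    have h1 := hgood.ne (g α) trivial (g β) trivial hαβ (by rwa [hg, hg])
    have hsymm := hgood.symm α (hx α) β (hx β)
    have hα := hgood.le α (hx α) β (hx β)
    have hβ := hsymm.trans_le (hgood.le β (hx β) α (hx α))
    rw [hg, hg, htr α _ hα, htr β _ hβ] at h1
    refine h1 ?_
    congr 2
    exact le_antisymm ((hπ _ _).2 ⟨le_rfl, le_rfl⟩) ((hπ _ _).2 ⟨le_rfl, hsymm.le⟩)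
  exact not_countable_iff.2 ‹Uncountable O› hinj.countable

/-- Under MA(ω₁) there is no wide Aronszajn tree which is universal for
wide Aronszajn trees under weak embeddings. -/
theorem no_universal_wide_Aronszajn (hMA : MAomega1.{u}) :
    ∀ (T : Type u) [PartialOrder T], IsWideAronszajn T →
      ¬ ∀ (S : Type u) [PartialOrder S], IsWideAronszajn S →
        ∃ f : S → T, IsWeakEmbedding f := by
  intro T _ hT hall
  obtain ⟨htree, hTc, hheight, hchain⟩ := hT
  obtain ⟨h, hh, hsurj⟩ := htree.exists_isLevel hheight
  have hOc : #omega1.{u}.ToType = ℵ₁ := mk_ord_toType _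
  have hO : ∀ a : omega1.{u}.ToType, (Iio a).Countable := fun a => by
    rw [← Cardinal.le_aleph0_iff_set_countable, ← Order.lt_succ_iff, succ_aleph0]
    exact (mk_Iio_lt a (by rw [hOc, type_toType, omega1])).trans_eq hOc
  have : Uncountable omega1.{u}.ToType := by
    rw [← not_countable_iff, ← Cardinal.mk_le_aleph0_iff, hOc, not_le]
    exact aleph0_lt_aleph_one
  obtain ⟨b, -, hb⟩ := wellFounded_lt.has_min (univ : Set omega1.{u}.ToType) univ_nonempty
  obtain ⟨c, Δ, d, hgood⟩ := exists_isGood hMA (fun x => not_lt.1 (hb x trivial)) hO hOc hTc hh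
    hsurj hchain
  have hx : ∀ x, x ∈ h '' univ := fun x => by rw [image_univ]; exact hsurj x
  have hsymm := fun x y => hgood.symm x (hx x) y (hx y)
  obtain ⟨S, _, ℓ, π, hℓ, hπ, hπℓ, hle⟩ := exists_isLevel_of_ultra
    (fun x => hgood.self x (hx x)) hsymm (fun x y z => hgood.ultra x (hx x) y (hx y) z (hx z))
  have hcard : #S ≤ ℵ₁ := by
    refine (mk_le_of_surjective hπ).trans ((mk_le_of_injective
      (f := fun p : BranchNode omega1.{u}.ToType => (p.branch, p.level)) ?_).trans ?_)
    · rintro ⟨_, _, _⟩ ⟨_, _, _⟩ H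
      simpa using H
    · rw [mk_prod, Cardinal.lift_id, hOc, mul_eq_self (aleph0_le_aleph 1)]
  obtain ⟨σ, hσ⟩ := hπ.hasRightInverse
  have hS : NoUncountableChain S := by
    refine hℓ.noUncountableChain hO hsymm
      (fun x ξ y η => hgood.le_of_eq x (hx x) ξ (hx ξ) y (hx y) η (hx η))
      (α := fun s => (σ s).branch) fun s t hst => ?_
    rw [← hσ s, ← hσ t, hle, ← hπℓ, hσ s] at hst
    exact hst.2
  obtain ⟨f, hf⟩ := hall S (hℓ.isWideAronszajn
    (fun ξ => ⟨π ⟨ξ, ξ, le_rfl⟩, hπℓ _⟩) hcard hS)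
  exact hgood.not_isWeakEmbedding hℓ hh hsurj hπℓ hle f hf
end

section
/- Assume MA(ω₁). Then there is no Aronszajn tree T such that every Aronszajn tree weakly embeds into T. -/
universe u

open Cardinal Ordinal Set Classical

theorem exists_uncountable_fiber_s1 {α X : Type*} [Countable X] (f : α → X) {I : Set α}
    (hI : ¬ I.Countable) : ∃ x, ¬ {a ∈ I | f a = x}.Countable := by
  by_contra! h
  exact hI ((Set.countable_iUnion h).mono fun a ha => by simp [ha])

/-- A weak form of the `Δ`-system lemma. -/
theorem exists_root {ι W : Type*} {A : Set ι} (hA : ¬ A.Countable) (F : ι → Finset W) :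
    ∃ R : Finset W, ∃ B ⊆ A, ¬ B.Countable ∧ (∀ p ∈ B, R ⊆ F p) ∧
      ∀ w ∉ R, {p ∈ B | w ∈ F p}.Countable := by
  obtain ⟨n, hn⟩ := exists_uncountable_fiber_s1 (fun p => (F p).card) hA
  let S : Set (Finset W) := {R | ¬ {p ∈ {p ∈ A | (F p).card = n} | R ⊆ F p}.Countable}
  have hS0 : ∅ ∈ S := by simpa [S] using hn
  have hbdd : BddAbove (Finset.card '' S) := by
    refine ⟨n, ?_⟩
    rintro _ ⟨R, hR, rfl⟩
    obtain ⟨p, hp⟩ : {p ∈ {p ∈ A | (F p).card = n} | R ⊆ F p}.Nonempty := by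
      rw [Set.nonempty_iff_ne_empty]
      exact fun h => hR (h ▸ Set.countable_empty)
    exact hp.1.2 ▸ Finset.card_le_card hp.2
  obtain ⟨R, hR, hRmax⟩ := Nat.sSup_mem ⟨_, Set.mem_image_of_mem _ hS0⟩ hbdd
  refine ⟨R, _, fun p hp => hp.1.1, hR, fun p hp => hp.2, fun w hw => ?_⟩
  by_contra hcon
  have hmem : insert w R ∈ S := by
    intro hc
    refine hcon (Set.Countable.mono ?_ hc)
    rintro p ⟨hp, hwp⟩
    exact ⟨hp.1, Finset.insert_subset hwp hp.2⟩
  have := le_csSup hbdd (Set.mem_image_of_mem _ hmem)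
  rw [← hRmax, Finset.card_insert_of_notMem hw] at this
  omega

/-- Level and restriction maps of a tree whose levels are countable and indexed by `W`.
The map `code` enumerates each level. -/
structure Levelling (W T : Type u) [LinearOrder W] [PartialOrder T] where
  lev : T → W
  res : T → W → T
  code : T → ℕ
  lev_strictMono : ∀ {x y : T}, x < y → lev x < lev y
  res_le : ∀ {t : T} {ξ : W}, ξ ≤ lev t → res t ξ ≤ t
  lev_res : ∀ {t : T} {ξ : W}, ξ ≤ lev t → lev (res t ξ) = ξ
  total_below : ∀ {u v t : T}, u ≤ t → v ≤ t → u ≤ v ∨ v ≤ u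
  code_inj : ∀ {t t' : T}, lev t = lev t' → code t = code t' → t = t'

namespace Levelling

variable {W T : Type u} [LinearOrder W] [PartialOrder T] (L : Levelling W T)

theorem eq_of_le_of_lev_eq {u v t : T} (hu : u ≤ t) (hv : v ≤ t) (h : L.lev u = L.lev v) :
    u = v := by
  rcases L.total_below hu hv with h1 | h1
  · rcases h1.eq_or_lt with h2 | h2
    · exact h2
    · exact absurd h (L.lev_strictMono h2).ne
  · rcases h1.eq_or_lt with h2 | h2
    · exact h2.symm
    · exact absurd h (L.lev_strictMono h2).ne'

/-- In a tree with no uncountable chain, an uncountable family of finite sets of bounded size,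
taken from increasing levels, contains two members with pairwise incomparable restrictions. -/
theorem exists_res_ne (hW : ∀ w : W, (Iic w).Countable)
    (hT : ∀ C : Set T, IsChain (· < ·) C → C.Countable)
    {I : Set W} (hI : ¬ I.Countable) (D : W → Finset T) (k : ℕ)
    (hk : ∀ α ∈ I, (D α).card = k) (hD : ∀ α ∈ I, ∀ t ∈ D α, α ≤ L.lev t) (b : W → W) :
    ∃ α ∈ I, ∃ β ∈ I, b α < β ∧ ∀ t ∈ D α, ∀ t' ∈ D β, L.res t α ≠ L.res t' α := by
  by_contra! hcon
  have : Filter.NeBot (Filter.cocardinal W isRegular_aleph_one ⊓ Filter.principal I) := by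
    rw [Filter.inf_principal_neBot_iff]
    intro s hs
    rw [Filter.mem_cocardinal] at hs
    by_contra hne
    rw [Set.not_nonempty_iff_eq_empty] at hne
    apply hI
    have hsc : sᶜ.Countable := by
      rw [← Cardinal.le_aleph0_iff_set_countable]
      rwa [← Order.lt_succ_iff, Cardinal.succ_aleph0]
    refine Set.Countable.mono (fun x hx => ?_) hsc
    intro hxs
    have : x ∈ s ∩ I := ⟨hxs, hx⟩
    simp [hne] at this
  let U := Ultrafilter.of (Filter.cocardinal W isRegular_aleph_one ⊓ Filter.principal I)
  have hU : (U : Filter W) ≤ Filter.cocardinal W isRegular_aleph_one ⊓ Filter.principal I :=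
    Ultrafilter.of_le _
  have hUI : ∀ᶠ β in (U : Filter W), β ∈ I := hU (Filter.mem_inf_of_right (by simp))
  have hUb : ∀ w : W, ∀ᶠ β in (U : Filter W), w < β := fun w => by
    refine hU (Filter.mem_inf_of_left ?_)
    rw [Filter.mem_cocardinal]
    have : {β | w < β}ᶜ = Iic w := by ext; simp
    rw [this, ← Cardinal.succ_aleph0, Order.lt_succ_iff, Cardinal.le_aleph0_iff_set_countable]
    exact hW w
  obtain ⟨t₀⟩ : Nonempty T := by
    obtain ⟨α, hα⟩ : I.Nonempty := by
      rw [Set.nonempty_iff_ne_empty]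
      exact fun h => hI (h ▸ Set.countable_empty)
    obtain ⟨β, hβ, h⟩ := (hUI.and (hUb (b α))).exists
    obtain ⟨t, -⟩ := hcon α hα β hβ h
    exact ⟨t⟩
  have henum : ∀ β, ∃ d : ℕ → T, β ∈ I → ∀ t ∈ D β, ∃ j < k, d j = t := fun β => by
    let e := (D β).equivFin
    refine ⟨fun j => if hj : j < (D β).card then (e.symm ⟨j, hj⟩ : T) else t₀, fun hβ t ht => ?_⟩
    exact ⟨e ⟨t, ht⟩, (hk β hβ) ▸ (e ⟨t, ht⟩).2, by simp⟩
  choose d hd using henum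
  have key : ∀ α, ∃ j : ℕ, ∃ x : T, α ∈ I → L.lev x = α ∧
      ∀ᶠ β in (U : Filter W), x ≤ d β j := by
    intro α
    by_cases hα : α ∈ I
    swap
    · exact ⟨0, d α 0, fun h => absurd h hα⟩
    have h1 : ∀ᶠ β in (U : Filter W), ∃ q ∈ ((D α ×ˢ Finset.range k : Finset (T × ℕ)) : Set (T × ℕ)),
        L.res q.1 α ≤ d β q.2 := by
      filter_upwards [hUI, hUb (b α), hUb α] with β hβ hb hαβ
      obtain ⟨t, ht, t', ht', h⟩ := hcon α hα β hβ hb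
      obtain ⟨j, hj, rfl⟩ := hd β hβ t' ht'
      refine ⟨(t, j), by simp [ht, hj], ?_⟩
      rw [h]
      exact L.res_le (hαβ.le.trans (hD β hβ _ ht'))
    rw [Ultrafilter.eventually_exists_mem_iff (Finset.finite_toSet _)] at h1
    obtain ⟨⟨t, j⟩, hq, h⟩ := h1
    simp only [Finset.coe_product, Set.mem_prod, Finset.mem_coe] at hq
    exact ⟨j, L.res t α, fun _ => ⟨L.lev_res (hD α hα t hq.1), h⟩⟩
  choose j x hx using key
  obtain ⟨m, hm⟩ := exists_uncountable_fiber_s1 j hI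
  apply hm
  have hinj : Set.InjOn x {α ∈ I | j α = m} := fun α hα β hβ h => by
    rw [← (hx α hα.1).1, ← (hx β hβ.1).1, h]
  refine Set.countable_of_injective_of_countable_image hinj (hT _ ?_)
  rintro _ ⟨α, ⟨hα, hjα⟩, rfl⟩ _ ⟨β, ⟨hβ, hjβ⟩, rfl⟩ hne
  have h1 := (hx α hα).2
  have h2 := (hx β hβ).2
  rw [hjα] at h1
  rw [hjβ] at h2
  obtain ⟨γ, hγ1, hγ2⟩ := (h1.and h2).exists
  rcases L.total_below hγ1 hγ2 with h | h
  · exact Or.inl (h.lt_of_ne hne)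
  · exact Or.inr (h.lt_of_ne hne.symm)

end Levelling

/-- A finite approximation to a coherent system of injections `g γ : Iic γ → ℕ` together with
a colouring `c` of `T` such that nodes `t`, `t'` of the same colour on different levels `γ`, `γ'`
split in `T` below a level on which `g γ` and `g γ'` still agree. -/
structure Condition {W T : Type u} [LinearOrder W] [PartialOrder T] (L : Levelling W T) where
  F : Finset W
  g : W → W → ℕ
  D : Finset T
  c : T → ℕ
  inj : ∀ γ ∈ F, ∀ η ∈ F, ∀ ξ ∈ F, η < ξ → ξ ≤ γ → g γ η ≠ g γ ξ
  coh : ∀ γ ∈ F, ∀ γ' ∈ F, ∀ η ∈ F, ∀ ξ ∈ F, η < ξ → ξ ≤ γ → ξ ≤ γ' → g γ ξ = g γ' ξ →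
    g γ η = g γ' η
  lev_mem : ∀ t ∈ D, L.lev t ∈ F
  col : ∀ t ∈ D, ∀ t' ∈ D, L.lev t ≠ L.lev t' → c t = c t' →
    ∃ ξ ∈ F, ξ ≤ L.lev t ∧ ξ ≤ L.lev t' ∧ g (L.lev t) ξ = g (L.lev t') ξ ∧
      L.res t ξ ≠ L.res t' ξ

namespace Condition

variable {W T : Type u} [LinearOrder W] [PartialOrder T] {L : Levelling W T}

instance : Preorder (Condition L) where
  le p q := p.F ⊆ q.F ∧ p.D ⊆ q.D ∧ (∀ γ ∈ p.F, ∀ ξ ∈ p.F, ξ ≤ γ → q.g γ ξ = p.g γ ξ) ∧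
    ∀ t ∈ p.D, q.c t = p.c t
  le_refl p := ⟨subset_rfl, subset_rfl, fun _ _ _ _ _ => rfl, fun _ _ => rfl⟩
  le_trans p q r h h' := ⟨h.1.trans h'.1, h.2.1.trans h'.2.1,
    fun γ hγ ξ hξ hle => (h'.2.2.1 γ (h.1 hγ) ξ (h.1 hξ) hle).trans (h.2.2.1 γ hγ ξ hξ hle),
    fun t ht => (h'.2.2.2 t (h.2.1 ht)).trans (h.2.2.2 t ht)⟩

theorem le_def {p q : Condition L} : p ≤ q ↔
    p.F ⊆ q.F ∧ p.D ⊆ q.D ∧ (∀ γ ∈ p.F, ∀ ξ ∈ p.F, ξ ≤ γ → q.g γ ξ = p.g γ ξ) ∧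
    ∀ t ∈ p.D, q.c t = p.c t := Iff.rfl

theorem exists_insert_color (p : Condition L) (t₀ : T) (ht₀ : L.lev t₀ ∈ p.F) :
    ∃ q, p ≤ q ∧ t₀ ∈ q.D := by
  by_cases hmem : t₀ ∈ p.D
  · exact ⟨p, le_rfl, hmem⟩
  obtain ⟨N, hN⟩ := Infinite.exists_notMem_finset (p.D.image p.c)
  have hN' : ∀ t ∈ p.D, p.c t ≠ N := fun t ht h => hN (Finset.mem_image.2 ⟨t, ht, h⟩)
  refine ⟨{ F := p.F, g := p.g, D := insert t₀ p.D, c := fun t => if t ∈ p.D then p.c t else N,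
            inj := p.inj, coh := p.coh, lev_mem := ?_, col := ?_ },
    ⟨subset_rfl, Finset.subset_insert _ _, fun _ _ _ _ _ => rfl, fun t ht => by simp [ht]⟩,
    Finset.mem_insert_self _ _⟩
  · intro t ht
    rcases Finset.mem_insert.1 ht with rfl | ht
    · exact ht₀
    · exact p.lev_mem t ht
  · intro t ht t' ht' hne hc
    by_cases h : t ∈ p.D <;> by_cases h' : t' ∈ p.D
    · simp only [h, h', if_true] at hc
      exact p.col t h t' h' hne hc
    · simp only [h, h', if_true, if_false] at hc
      exact absurd hc (hN' t h)
    · simp only [h, h', if_true, if_false] at hc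
      exact absurd hc.symm (hN' t' h')
    · rw [Finset.mem_insert, or_iff_left h] at ht
      rw [Finset.mem_insert, or_iff_left h'] at ht'
      rw [ht, ht'] at hne
      exact absurd rfl hne

/-- Two conditions with the same trace below `α`, and such that the second one looks above `α`
like a subset of the first one, have a common extension in which the level `α` witnesses that
new pairs of nodes of the same colour split early. -/
theorem exists_amalgam (p q : Condition L) {α e e' : W} (hα : α < e)
    (hp : ∀ x ∈ p.F, x < α ∨ (e ≤ x ∧ e ∈ p.F))
    (hq : ∀ x ∈ q.F, x < α ∨ (e' ≤ x ∧ e' ∈ q.F))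
    (hpe : ∀ x ∈ p.F, x < e') (hαe : α < e')
    (hF : ∀ x < α, (x ∈ p.F ↔ x ∈ q.F))
    (hg : ∀ x ∈ p.F, ∀ y ∈ p.F, x < α → y < α → p.g x y = q.g x y)
    (hD : ∀ t, L.lev t < α → (t ∈ p.D ↔ t ∈ q.D))
    (hc : ∀ t ∈ p.D, L.lev t < α → p.c t = q.c t)
    (twin : ∀ γ' ∈ q.F, e' ≤ γ' → ∃ γ ∈ p.F, e ≤ γ ∧ p.g γ e = q.g γ' e' ∧
      ∀ ξ ∈ p.F, ξ < α → p.g γ ξ = q.g γ' ξ)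
    (twinD : ∀ t' ∈ q.D, e' ≤ L.lev t' → ∃ t ∈ p.D, e ≤ L.lev t ∧ p.c t = q.c t' ∧
      p.g (L.lev t) e = q.g (L.lev t') e' ∧
      ∀ ξ ∈ p.F, ξ < α → p.g (L.lev t) ξ = q.g (L.lev t') ξ ∧ L.res t ξ = L.res t' ξ)
    (hne : ∀ t ∈ p.D, e ≤ L.lev t → ∀ t' ∈ q.D, e' ≤ L.lev t' → L.res t α ≠ L.res t' α) :
    ∃ r : Condition L, p ≤ r ∧ q ≤ r ∧ r.F = insert α (p.F ∪ q.F) := by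
  have hαp : α ∉ p.F := fun h => (hp α h).elim (lt_irrefl _) fun h' => h'.1.not_gt hα
  have hαq : α ∉ q.F := fun h => (hq α h).elim (lt_irrefl _) fun h' => h'.1.not_gt hαe
  have hpq : ∀ x ∈ p.F, x ∈ q.F → x < α := fun x hx hx' =>
    (hq x hx').elim id fun h => absurd (hpe x hx) h.1.not_gt
  obtain ⟨N, hN⟩ : ∃ N, ∀ x ∈ p.F ∪ q.F, ∀ y ∈ p.F ∪ q.F, p.g x y < N ∧ q.g x y < N := by
    refine ⟨((p.F ∪ q.F) ×ˢ (p.F ∪ q.F)).sup (fun z => p.g z.1 z.2 + q.g z.1 z.2) + 1,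
      fun x hx y hy => ?_⟩
    have := Finset.le_sup (f := fun z : W × W => p.g z.1 z.2 + q.g z.1 z.2)
      (Finset.mk_mem_product hx hy)
    simp only at this
    omega
  have hNp : ∀ x ∈ p.F, ∀ y ∈ p.F, p.g x y < N := fun x hx y hy =>
    (hN x (Finset.mem_union_left _ hx) y (Finset.mem_union_left _ hy)).1
  have hNq : ∀ x ∈ q.F, ∀ y ∈ q.F, q.g x y < N := fun x hx y hy =>
    (hN x (Finset.mem_union_right _ hx) y (Finset.mem_union_right _ hy)).2
  obtain ⟨k, hk⟩ : ∃ k : W → ℕ, Set.InjOn k (insert α (p.F ∪ q.F) : Finset W) :=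
    Set.countable_iff_exists_injOn.1 (Finset.countable_toSet _)
  let m : W → ℕ := fun γ => if γ = α then N else if γ ∈ p.F then p.g γ e else q.g γ e'
  let G : W → W → ℕ := fun γ ξ =>
    if γ ∈ p.F ∧ ξ ∈ p.F then p.g γ ξ
    else if γ ∈ q.F ∧ ξ ∈ q.F then q.g γ ξ
    else N + Nat.pair (k ξ) (m γ)
  have Gp : ∀ x ∈ p.F, ∀ y ∈ p.F, G x y = p.g x y := fun x hx y hy => if_pos ⟨hx, hy⟩
  have Gq : ∀ x ∈ q.F, ∀ y ∈ q.F, G x y = q.g x y := fun x hx y hy => by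
    by_cases h : x ∈ p.F ∧ y ∈ p.F
    · rw [Gp x h.1 y h.2, hg x h.1 y h.2 (hpq x h.1 hx) (hpq y h.2 hy)]
    · simp only [G, if_neg h, if_pos (And.intro hx hy)]
  have Gn : ∀ x y, ¬ (x ∈ p.F ∧ y ∈ p.F) → ¬ (x ∈ q.F ∧ y ∈ q.F) →
      G x y = N + Nat.pair (k y) (m x) := fun x y h h' => by
    simp only [G, if_neg h, if_neg h']
  have zone : ∀ x ∈ insert α (p.F ∪ q.F), (x < α ∧ x ∈ p.F ∧ x ∈ q.F) ∨ x = α ∨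
      (e ≤ x ∧ x < e' ∧ x ∈ p.F ∧ e ∈ p.F ∧ x ∉ q.F) ∨
      (e' ≤ x ∧ x ∈ q.F ∧ e' ∈ q.F ∧ x ∉ p.F) := by
    intro x hx
    rw [Finset.mem_insert, Finset.mem_union] at hx
    rcases hx with rfl | hx | hx
    · exact Or.inr (Or.inl rfl)
    · rcases hp x hx with h | h
      · exact Or.inl ⟨h, hx, (hF x h).1 hx⟩
      · exact Or.inr (Or.inr (Or.inl ⟨h.1, hpe x hx, hx, h.2, fun hx' =>
          (hα.trans_le h.1).not_gt (hpq x hx hx')⟩))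
    · rcases hq x hx with h | h
      · exact Or.inl ⟨h, (hF x h).2 hx, hx⟩
      · exact Or.inr (Or.inr (Or.inr ⟨h.1, hx, h.2, fun hx' => h.1.not_gt (hpe x hx')⟩))
  have mα : m α = N := if_pos rfl
  have mp : ∀ x ∈ p.F, m x = p.g x e := fun x hx => by
    have : x ≠ α := fun h => hαp (h ▸ hx)
    simp only [m, if_neg this, if_pos hx]
  have mq : ∀ x ∈ q.F, x ∉ p.F → m x = q.g x e' := fun x hx hx' => by
    have : x ≠ α := fun h => hαq (h ▸ hx)
    simp only [m, if_neg this, if_neg hx']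
  have like : ∀ γ ∈ p.F ∪ q.F, ∃ γ₁ ∈ p.F, (∀ ξ < α, ξ ≤ γ → ξ ≤ γ₁) ∧
      ∀ ξ ∈ p.F, ξ < α → G γ ξ = p.g γ₁ ξ := by
    intro γ hγ
    rcases zone γ (Finset.mem_insert_of_mem hγ) with h | h | h | h
    · exact ⟨γ, h.2.1, fun _ _ h => h, fun ξ hξ _ => Gp γ h.2.1 ξ hξ⟩
    · rw [Finset.mem_union] at hγ
      exact absurd (h ▸ hγ) (by simp [hαp, hαq])
    · exact ⟨γ, h.2.2.1, fun _ _ h => h, fun ξ hξ _ => Gp γ h.2.2.1 ξ hξ⟩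
    · obtain ⟨γ₁, h1, h2, -, h4⟩ := twin γ h.2.1 h.1
      exact ⟨γ₁, h1, fun ξ hξ _ => (hξ.trans (hα.trans_le h2)).le, fun ξ hξ hξα => by
        rw [Gq γ h.2.1 ξ ((hF ξ hξα).1 hξ), h4 ξ hξ hξα]⟩
  have like' : ∀ γ ∈ insert α (p.F ∪ q.F), α < γ → ∃ γ₁ ∈ p.F, e ∈ p.F ∧ e ≤ γ₁ ∧
      m γ = p.g γ₁ e ∧ ∀ ξ ∈ p.F, ξ < α → G γ ξ = p.g γ₁ ξ := by
    intro γ hγ hγα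
    rcases zone γ hγ with h | h | h | h
    · exact absurd h.1 hγα.not_gt
    · exact absurd h hγα.ne'
    · exact ⟨γ, h.2.2.1, h.2.2.2.1, h.1, mp γ h.2.2.1, fun ξ hξ _ => Gp γ h.2.2.1 ξ hξ⟩
    · obtain ⟨γ₁, h1, h2, h3, h4⟩ := twin γ h.2.1 h.1
      refine ⟨γ₁, h1, ?_, h2, by rw [mq γ h.2.1 h.2.2.2, h3], fun ξ hξ hξα => by
        rw [Gq γ h.2.1 ξ ((hF ξ hξα).1 hξ), h4 ξ hξ hξα]⟩
      exact (hp γ₁ h1).elim (fun h => absurd h (hα.trans_le h2).not_gt) And.right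
  have m_lt : ∀ γ ∈ insert α (p.F ∪ q.F), α < γ → m γ < N := fun γ hγ hγα => by
    obtain ⟨γ₁, h1, h2, -, h3, -⟩ := like' γ hγ hγα
    rw [h3]
    exact hNp _ h1 _ h2
  have m_eq : ∀ γ ∈ insert α (p.F ∪ q.F), ∀ γ' ∈ insert α (p.F ∪ q.F), α ≤ γ → α ≤ γ' →
      m γ = m γ' → ∀ ξ ∈ p.F, ξ < α → G γ ξ = G γ' ξ := by
    intro γ hγ γ' hγ' h h' hm ξ hξ hξα
    rcases h.eq_or_lt with rfl | h <;> rcases h'.eq_or_lt with rfl | h'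
    · rfl
    · exact absurd (hm.symm.trans mα) (m_lt _ hγ' h').ne
    · exact absurd (hm.trans mα) (m_lt _ hγ h).ne
    · obtain ⟨γ₁, h1, he, h2, h3, h4⟩ := like' γ hγ h
      obtain ⟨γ₂, k1, -, k2, k3, k4⟩ := like' γ' hγ' h'
      rw [h4 ξ hξ hξα, k4 ξ hξ hξα]
      exact p.coh _ h1 _ k1 _ hξ _ he (hξα.trans hα) h2 k2 (by rw [← h3, ← k3, hm])
  have pair_inj : ∀ x y x' y', N + Nat.pair (k y) (m x) = N + Nat.pair (k y') (m x') →
      k y = k y' ∧ m x = m x' := fun x y x' y' h => Nat.pair_eq_pair.1 (Nat.add_left_cancel h)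
  refine ⟨{ F := insert α (p.F ∪ q.F), g := G, D := p.D ∪ q.D,
            c := fun t => if t ∈ p.D then p.c t else q.c t,
            inj := ?_, coh := ?_, lev_mem := ?_, col := ?_ },
    ⟨fun x hx => by simp [hx], Finset.subset_union_left, fun γ hγ ξ hξ _ => Gp γ hγ ξ hξ,
      fun t ht => if_pos ht⟩,
    ⟨fun x hx => by simp [hx], Finset.subset_union_right, fun γ hγ ξ hξ _ => Gq γ hγ ξ hξ,
      fun t ht => ?_⟩, rfl⟩
  · intro γ hγ η hη ξ hξ hlt hle heq
    by_cases h1 : γ ∈ p.F ∧ η ∈ p.F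
    · by_cases h2 : γ ∈ p.F ∧ ξ ∈ p.F
      · rw [Gp _ h1.1 _ h1.2, Gp _ h2.1 _ h2.2] at heq
        exact p.inj _ h1.1 _ h1.2 _ h2.2 hlt hle heq
      · by_cases h3 : γ ∈ q.F ∧ ξ ∈ q.F
        · exact h2 ⟨h1.1, (hF ξ (hle.trans_lt (hpq γ h1.1 h3.1))).2 h3.2⟩
        · rw [Gp _ h1.1 _ h1.2, Gn _ _ h2 h3] at heq
          have := hNp _ h1.1 _ h1.2
          omega
    · by_cases h1' : γ ∈ q.F ∧ η ∈ q.F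
      · by_cases h2 : γ ∈ q.F ∧ ξ ∈ q.F
        · rw [Gq _ h1'.1 _ h1'.2, Gq _ h2.1 _ h2.2] at heq
          exact q.inj _ h2.1 _ h1'.2 _ h2.2 hlt hle heq
        · by_cases h3 : γ ∈ p.F ∧ ξ ∈ p.F
          · exact h2 ⟨h1'.1, (hF ξ (hle.trans_lt (hpq γ h3.1 h1'.1))).1 h3.2⟩
          · rw [Gq _ h1'.1 _ h1'.2, Gn _ _ h3 h2] at heq
            have := hNq _ h1'.1 _ h1'.2
            omega
      · rw [Gn _ _ h1 h1'] at heq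
        by_cases h2 : γ ∈ p.F ∧ ξ ∈ p.F
        · rw [Gp _ h2.1 _ h2.2] at heq
          have := hNp _ h2.1 _ h2.2
          omega
        · by_cases h3 : γ ∈ q.F ∧ ξ ∈ q.F
          · rw [Gq _ h3.1 _ h3.2] at heq
            have := hNq _ h3.1 _ h3.2
            omega
          · rw [Gn _ _ h2 h3] at heq
            exact hlt.ne (hk hη hξ (pair_inj _ _ _ _ heq).1)
  · intro γ hγ γ' hγ' η hη ξ hξ hlt hle hle' heq
    rcases zone ξ hξ with h | rfl | h | h
    · have hηα : η < α := hlt.trans h.1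
      have hηp : η ∈ p.F := by
        rcases zone η hη with h | h | h | h
        · exact h.2.1
        · exact absurd h hηα.ne
        · exact absurd (hηα.trans hα) h.1.not_gt
        · exact absurd (hηα.trans hαe) h.1.not_gt
      have old : ∀ x ∈ p.F ∪ q.F, G x ξ < N := fun x hx => by
        rcases Finset.mem_union.1 hx with hx | hx
        · rw [Gp _ hx _ h.2.1]
          exact hNp _ hx _ h.2.1
        · rw [Gq _ hx _ h.2.2]
          exact hNq _ hx _ h.2.2
      have new : N ≤ G α ξ := by
        rw [Gn _ _ (fun h => hαp h.1) (fun h => hαq h.1)]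
        omega
      rw [Finset.mem_insert] at hγ hγ'
      rcases hγ with rfl | hγ <;> rcases hγ' with rfl | hγ'
      · rfl
      · exact absurd (old _ hγ') (heq ▸ new).not_gt
      · exact absurd (old _ hγ) (heq ▸ new).not_gt
      · obtain ⟨γ₁, h1, h2, h3⟩ := like γ hγ
        obtain ⟨γ₂, k1, k2, k3⟩ := like γ' hγ'
        rw [h3 η hηp hηα, k3 η hηp hηα]
        rw [h3 ξ h.2.1 h.1, k3 ξ h.2.1 h.1] at heq
        exact p.coh _ h1 _ k1 _ hηp _ h.2.1 hlt (h2 ξ h.1 hle) (k2 ξ h.1 hle') heq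
    · rw [Gn _ _ (fun h => hαp h.2) (fun h => hαq h.2),
        Gn _ _ (fun h => hαp h.2) (fun h => hαq h.2)] at heq
      have hηp : η ∈ p.F := by
        rcases zone η hη with h | h | h | h
        · exact h.2.1
        · exact absurd h hlt.ne
        · exact absurd (hlt.trans hα) h.1.not_gt
        · exact absurd (hlt.trans hαe) h.1.not_gt
      exact m_eq _ hγ _ hγ' hle hle' (pair_inj _ _ _ _ heq).2 η hηp hlt
    · have hαξ := hα.trans_le h.1
      have hpart : ∀ x ∈ insert α (p.F ∪ q.F), ξ ≤ x → x ∈ p.F ∨ (x ∈ q.F ∧ x ∉ p.F) := by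
        intro x hx hξx
        rcases zone x hx with h | h | h | h
        · exact Or.inl h.2.1
        · exact absurd hξx (h ▸ hαξ).not_ge
        · exact Or.inl h.2.2.1
        · exact Or.inr ⟨h.2.1, h.2.2.2⟩
      have new : ∀ x, x ∈ q.F ∧ x ∉ p.F → G x ξ = N + Nat.pair (k ξ) (m x) := fun x hx =>
        Gn _ _ (fun h' => hx.2 h'.1) (fun h' => h.2.2.2.2 h'.2)
      rcases hpart γ hγ hle with h1 | h1 <;> rcases hpart γ' hγ' hle' with h2 | h2
      · rw [Gp _ h1 _ h.2.2.1, Gp _ h2 _ h.2.2.1] at heq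
        have hm : m γ = m γ' := by
          rw [mp _ h1, mp _ h2]
          rcases h.1.eq_or_lt with h3 | h3
          · rw [h3, heq]
          · exact p.coh _ h1 _ h2 _ h.2.2.2.1 _ h.2.2.1 h3 hle hle' heq
        by_cases hηp : η ∈ p.F
        · rw [Gp _ h1 _ hηp, Gp _ h2 _ hηp]
          exact p.coh _ h1 _ h2 _ hηp _ h.2.2.1 hlt hle hle' heq
        · have hγq : ∀ x ∈ p.F, ξ ≤ x → x ∉ q.F := fun x hx hξx hxq =>
            (hαξ.trans_le hξx).not_gt (hpq x hx hxq)
          rw [Gn _ _ (fun h => hηp h.2) (fun h => hγq _ h1 hle h.1),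
            Gn _ _ (fun h => hηp h.2) (fun h => hγq _ h2 hle' h.1), hm]
      · rw [Gp _ h1 _ h.2.2.1, new _ h2] at heq
        have := hNp _ h1 _ h.2.2.1
        omega
      · rw [Gp _ h2 _ h.2.2.1, new _ h1] at heq
        have := hNp _ h2 _ h.2.2.1
        omega
      · rw [new _ h1, new _ h2] at heq
        have hm := (pair_inj _ _ _ _ heq).2
        by_cases hηq : η ∈ q.F
        · have hηα : η < α := by
            rcases zone η hη with h' | h' | h' | h'
            · exact h'.1
            · exact absurd (h' ▸ hηq) hαq
            · exact absurd hηq h'.2.2.2.2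
            · exact absurd (hlt.trans h.2.1) h'.1.not_gt
          exact m_eq _ hγ _ hγ' (hαξ.le.trans hle) (hαξ.le.trans hle') hm η
            ((hF η hηα).2 hηq) hηα
        · rw [Gn _ _ (fun h => h1.2 h.1) (fun h => hηq h.2),
            Gn _ _ (fun h => h2.2 h.1) (fun h => hηq h.2), hm]
    · have hpart : ∀ x ∈ insert α (p.F ∪ q.F), ξ ≤ x → x ∈ q.F ∧ x ∉ p.F := by
        intro x hx hξx
        have hex := h.1.trans hξx
        rcases zone x hx with h' | h' | h' | h'
        · exact absurd (h'.1.trans hαe) hex.not_gt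
        · exact absurd (h' ▸ hαe) hex.not_gt
        · exact absurd h'.2.1 hex.not_gt
        · exact ⟨h'.2.1, h'.2.2.2⟩
      have h1 := hpart γ hγ hle
      have h2 := hpart γ' hγ' hle'
      rw [Gq _ h1.1 _ h.2.1, Gq _ h2.1 _ h.2.1] at heq
      have hm : m γ = m γ' := by
        rw [mq _ h1.1 h1.2, mq _ h2.1 h2.2]
        rcases h.1.eq_or_lt with h3 | h3
        · rw [h3, heq]
        · exact q.coh _ h1.1 _ h2.1 _ h.2.2.1 _ h.2.1 h3 hle hle' heq
      by_cases hηq : η ∈ q.F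
      · rw [Gq _ h1.1 _ hηq, Gq _ h2.1 _ hηq]
        exact q.coh _ h1.1 _ h2.1 _ hηq _ h.2.1 hlt hle hle' heq
      · rw [Gn _ _ (fun h => h1.2 h.1) (fun h => hηq h.2),
          Gn _ _ (fun h => h2.2 h.1) (fun h => hηq h.2), hm]
  · intro t ht
    rw [Finset.mem_insert, Finset.mem_union]
    rcases Finset.mem_union.1 ht with ht | ht
    · exact Or.inr (Or.inl (p.lev_mem t ht))
    · exact Or.inr (Or.inr (q.lev_mem t ht))
  · have cq : ∀ t ∈ q.D, (if t ∈ p.D then p.c t else q.c t) = q.c t := fun t ht => by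
      by_cases h : t ∈ p.D
      · rw [if_pos h, hc t h (hpq _ (p.lev_mem t h) (q.lev_mem t ht))]
      · rw [if_neg h]
    have cp : ∀ t ∈ p.D, (if t ∈ p.D then p.c t else q.c t) = p.c t := fun t ht => if_pos ht
    have inF : ∀ x ∈ p.F, x ∈ insert α (p.F ∪ q.F) := fun x hx => by simp [hx]
    have inF' : ∀ x ∈ q.F, x ∈ insert α (p.F ∪ q.F) := fun x hx => by simp [hx]
    have colp : ∀ t ∈ p.D, ∀ t' ∈ p.D, L.lev t ≠ L.lev t' → p.c t = p.c t' →
        ∃ ξ ∈ insert α (p.F ∪ q.F), ξ ≤ L.lev t ∧ ξ ≤ L.lev t' ∧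
          G (L.lev t) ξ = G (L.lev t') ξ ∧ L.res t ξ ≠ L.res t' ξ := by
      intro t ht t' ht' hlev heq
      obtain ⟨ξ, h1, h2, h3, h4, h5⟩ := p.col t ht t' ht' hlev heq
      exact ⟨ξ, inF ξ h1, h2, h3, by
        rw [Gp _ (p.lev_mem t ht) _ h1, Gp _ (p.lev_mem t' ht') _ h1, h4], h5⟩
    have colq : ∀ t ∈ q.D, ∀ t' ∈ q.D, L.lev t ≠ L.lev t' → q.c t = q.c t' →
        ∃ ξ ∈ insert α (p.F ∪ q.F), ξ ≤ L.lev t ∧ ξ ≤ L.lev t' ∧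
          G (L.lev t) ξ = G (L.lev t') ξ ∧ L.res t ξ ≠ L.res t' ξ := by
      intro t ht t' ht' hlev heq
      obtain ⟨ξ, h1, h2, h3, h4, h5⟩ := q.col t ht t' ht' hlev heq
      exact ⟨ξ, inF' ξ h1, h2, h3, by
        rw [Gq _ (q.lev_mem t ht) _ h1, Gq _ (q.lev_mem t' ht') _ h1, h4], h5⟩
    have colpq : ∀ t ∈ p.D, ∀ t' ∈ q.D, L.lev t ≠ L.lev t' → p.c t = q.c t' →
        ∃ ξ ∈ insert α (p.F ∪ q.F), ξ ≤ L.lev t ∧ ξ ≤ L.lev t' ∧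
          G (L.lev t) ξ = G (L.lev t') ξ ∧ L.res t ξ ≠ L.res t' ξ := by
      intro t ht t' ht' hlev heq
      have htF := p.lev_mem t ht
      have htF' := q.lev_mem t' ht'
      rcases hp _ htF with hlow | ⟨het, heF⟩
      · exact colq t ((hD t hlow).1 ht) t' ht' hlev ((hc t ht hlow).symm.trans heq)
      rcases hq _ htF' with hlow | ⟨het', heF'⟩
      · have ht'p := (hD t' hlow).2 ht'
        exact colp t ht t' ht'p hlev (heq.trans (hc t' ht'p hlow).symm)
      have htnp : L.lev t' ∉ p.F := fun h => het'.not_gt (hpe _ h)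
      by_cases hm : m (L.lev t) = m (L.lev t')
      · refine ⟨α, Finset.mem_insert_self _ _, (hα.trans_le het).le, (hαe.trans_le het').le, ?_,
          hne t ht het t' ht' het'⟩
        rw [Gn _ _ (fun h => hαp h.2) (fun h => hαq h.2),
          Gn _ _ (fun h => hαp h.2) (fun h => hαq h.2), hm]
      · obtain ⟨s, hs, hes, hcs, hms, hsξ⟩ := twinD t' ht' het'
        rw [mp _ htF, mq _ htF' htnp, ← hms] at hm
        obtain ⟨ξ, h1, h2, h3, h4, h5⟩ :=
          p.col t ht s hs (fun h => hm (by rw [h])) (heq.trans hcs.symm)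
        rcases hp ξ h1 with hξ | ⟨hξ, -⟩
        · refine ⟨ξ, inF ξ h1, h2, (hξ.trans (hαe.trans_le het')).le, ?_, ?_⟩
          · rw [Gp _ htF _ h1, Gq _ htF' _ ((hF ξ hξ).1 h1), h4, (hsξ ξ h1 hξ).1]
          · rw [← (hsξ ξ h1 hξ).2]
            exact h5
        · refine absurd ?_ hm
          rcases hξ.eq_or_lt with rfl | hξ
          · exact h4
          · exact p.coh _ htF _ (p.lev_mem s hs) _ heF _ h1 hξ h2 h3 h4
    intro t ht t' ht' hlev heq
    rcases Finset.mem_union.1 ht with ht | ht <;> rcases Finset.mem_union.1 ht' with ht' | ht'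
    · rw [cp t ht, cp t' ht'] at heq
      exact colp t ht t' ht' hlev heq
    · rw [cp t ht, cq t' ht'] at heq
      exact colpq t ht t' ht' hlev heq
    · rw [cq t ht, cp t' ht'] at heq
      obtain ⟨ξ, h1, h2, h3, h4, h5⟩ := colpq t' ht' t ht hlev.symm heq.symm
      exact ⟨ξ, h1, h3, h2, h4.symm, h5.symm⟩
    · rw [cq t ht, cq t' ht'] at heq
      exact colq t ht t' ht' hlev heq
  · change (if t ∈ p.D then p.c t else q.c t) = q.c t
    by_cases h : t ∈ p.D
    · rw [if_pos h, hc t h (hpq _ (p.lev_mem t h) (q.lev_mem t ht))]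
    · rw [if_neg h]

theorem exists_insert_level [NoMaxOrder W] (p : Condition L) (α : W) :
    ∃ q, p ≤ q ∧ q.F = insert α p.F := by
  by_cases hα : α ∈ p.F
  · exact ⟨p, le_rfl, (Finset.insert_eq_of_mem hα).symm⟩
  let q : Condition L :=
    { F := p.F.filter (· < α), g := p.g, D := p.D.filter (L.lev · < α), c := p.c
      inj := fun γ hγ η hη ξ hξ => p.inj γ (Finset.mem_filter.1 hγ).1 η (Finset.mem_filter.1 hη).1 ξ
        (Finset.mem_filter.1 hξ).1
      coh := fun γ hγ γ' hγ' η hη ξ hξ => p.coh γ (Finset.mem_filter.1 hγ).1 γ'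
        (Finset.mem_filter.1 hγ').1 η (Finset.mem_filter.1 hη).1 ξ (Finset.mem_filter.1 hξ).1
      lev_mem := fun t ht => by
        rw [Finset.mem_filter] at ht ⊢
        exact ⟨p.lev_mem t ht.1, ht.2⟩
      col := fun t ht t' ht' h h' => by
        rw [Finset.mem_filter] at ht ht'
        obtain ⟨ξ, hξ, h1, h2⟩ := p.col t ht.1 t' ht'.1 h h'
        exact ⟨ξ, Finset.mem_filter.2 ⟨hξ, h1.trans_lt ht.2⟩, h1, h2⟩ }
  obtain ⟨e, hαe, he⟩ : ∃ e, α < e ∧ ∀ x ∈ p.F, x < α ∨ (e ≤ x ∧ e ∈ p.F) := by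
    by_cases hne : (p.F.filter (α < ·)).Nonempty
    · have hmin := Finset.min'_mem _ hne
      rw [Finset.mem_filter] at hmin
      refine ⟨_, hmin.2, fun x hx => ?_⟩
      rcases lt_trichotomy x α with h | h | h
      · exact Or.inl h
      · exact absurd (h ▸ hx) hα
      · exact Or.inr ⟨Finset.min'_le _ _ (Finset.mem_filter.2 ⟨hx, h⟩), hmin.1⟩
    · obtain ⟨e, he⟩ := exists_gt α
      refine ⟨e, he, fun x hx => ?_⟩
      rcases lt_trichotomy x α with h | h | h
      · exact Or.inl h
      · exact absurd (h ▸ hx) hα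
      · exact absurd ⟨x, Finset.mem_filter.2 ⟨hx, h⟩⟩ hne
  obtain ⟨e', he'⟩ := exists_gt ((insert α p.F).max' (Finset.insert_nonempty _ _))
  have he'' : ∀ x ∈ insert α p.F, x < e' := fun x hx => (Finset.le_max' _ _ hx).trans_lt he'
  have hαe' : α < e' := he'' α (Finset.mem_insert_self _ _)
  have hqF : ∀ x ∈ q.F, x < α := fun x hx => (Finset.mem_filter.1 hx).2
  have hqD : ∀ t ∈ q.D, L.lev t < α := fun x hx => (Finset.mem_filter.1 hx).2
  obtain ⟨r, hpr, -, hr⟩ := exists_amalgam p q hαe he (fun x hx => Or.inl (hqF x hx))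
    (fun x hx => he'' x (Finset.mem_insert_of_mem hx)) hαe'
    (fun x hx => by simp [q, hx]) (fun _ _ _ _ _ _ => rfl)
    (fun t ht => by simp [q, ht]) (fun _ _ _ => rfl)
    (fun x hx h => absurd (hqF x hx) (hαe'.le.trans h).not_gt)
    (fun t ht h => absurd (hqD t ht) (hαe'.le.trans h).not_gt)
    (fun _ _ _ t ht h => absurd (hqD t ht) (hαe'.le.trans h).not_gt)
  refine ⟨r, hpr, ?_⟩
  rw [hr, Finset.union_eq_left.2 (Finset.filter_subset _ _)]

end Condition

namespace Condition

variable {W T : Type u} [LinearOrder W] [PartialOrder T] {L : Levelling W T}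

/-- The countably many possible isomorphism types of a condition over a root `R`, where `k`
enumerates `R`, and `e` is the least index of the condition which is not in `R`. -/
noncomputable def isoType (R : Finset W) (k : W → ℕ) (e : W) (p : Condition L) :
    (R → R → ℕ) × Finset (ℕ × ℕ × ℕ) × Finset (ℕ × (R → ℕ)) ×
      Finset (ℕ × ℕ × (R → ℕ × ℕ)) × ℕ :=
  (fun x y => p.g x y,
    (p.D.filter (L.lev · ∈ R)).image fun t => (k (L.lev t), L.code t, p.c t),
    (p.F.filter (e ≤ ·)).image fun γ => (p.g γ e, fun ξ => p.g γ ξ),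
    (p.D.filter (e ≤ L.lev ·)).image fun t =>
      (p.c t, p.g (L.lev t) e, fun ξ => (p.g (L.lev t) ξ, L.code (L.res t ξ))),
    (p.D.filter (e ≤ L.lev ·)).card)

theorem mem_of_isoType_eq {R : Finset W} {k : W → ℕ} (hk : Set.InjOn k R) {e e' : W}
    {p q : Condition L} (h : isoType R k e p = isoType R k e' q) {t : T} (ht : t ∈ p.D)
    (htR : L.lev t ∈ R) : t ∈ q.D ∧ p.c t = q.c t := by
  have h2 := congrArg (fun x => x.2.1) h
  simp only [isoType] at h2
  have hmem : (k (L.lev t), L.code t, p.c t) ∈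
      (p.D.filter (L.lev · ∈ R)).image fun t => (k (L.lev t), L.code t, p.c t) :=
    Finset.mem_image_of_mem _ (Finset.mem_filter.2 ⟨ht, htR⟩)
  rw [h2, Finset.mem_image] at hmem
  obtain ⟨s, hs, heq⟩ := hmem
  rw [Finset.mem_filter] at hs
  simp only [Prod.mk.injEq] at heq
  have : s = t := L.code_inj (hk hs.2 htR heq.1) heq.2.1
  subst this
  exact ⟨hs.1, heq.2.2.symm⟩

/-- Conditions of the same type over a root, living on separate intervals above the root, are
compatible as soon as the restrictions of their nodes to level `α` are different. -/
theorem exists_le_of_isoType_eq {R : Finset W} {k : W → ℕ} (hk : Set.InjOn k R) {α e e' : W}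
    {p q : Condition L} (h : isoType R k e p = isoType R k e' q) (hα : α < e) (hαe : α < e')
    (hRα : ∀ x ∈ R, x < α) (hRp : R ⊆ p.F) (hRq : R ⊆ q.F) (hep : e ∈ p.F) (heq : e' ∈ q.F)
    (hp : ∀ x ∈ p.F, x ∈ R ∨ e ≤ x) (hq : ∀ x ∈ q.F, x ∈ R ∨ e' ≤ x)
    (hpe : ∀ x ∈ p.F, x < e')
    (hne : ∀ t ∈ p.D, e ≤ L.lev t → ∀ t' ∈ q.D, e' ≤ L.lev t' → L.res t α ≠ L.res t' α) :
    ∃ r, p ≤ r ∧ q ≤ r := by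
  have hpR : ∀ x ∈ p.F, x < α → x ∈ R := fun x hx hxα =>
    (hp x hx).elim id fun h => absurd (hxα.trans hα) h.not_gt
  have hqR : ∀ x ∈ q.F, x < α → x ∈ R := fun x hx hxα =>
    (hq x hx).elim id fun h => absurd (hxα.trans hαe) h.not_gt
  obtain ⟨r, h1, h2, -⟩ := exists_amalgam p q hα
    (fun x hx => (hp x hx).imp (hRα x) fun h => ⟨h, hep⟩)
    (fun x hx => (hq x hx).imp (hRα x) fun h => ⟨h, heq⟩) hpe hαe
    (fun x hx => ⟨fun h => hRq (hpR x h hx), fun h => hRp (hqR x h hx)⟩)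
    (fun x hx y hy hxα hyα => by
      have h1 := congrArg (fun z => z.1) h
      exact congrFun (congrFun h1 ⟨x, hpR x hx hxα⟩) ⟨y, hpR y hy hyα⟩)
    (fun t ht => ⟨fun h' => (mem_of_isoType_eq hk h h' (hpR _ (p.lev_mem t h') ht)).1,
      fun h' => (mem_of_isoType_eq hk h.symm h' (hqR _ (q.lev_mem t h') ht)).1⟩)
    (fun t ht hlev => (mem_of_isoType_eq hk h ht (hpR _ (p.lev_mem t ht) hlev)).2)
    (fun γ hγ hγe => by
      have h3 := congrArg (fun z => z.2.2.1) h
      simp only [isoType] at h3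
      have hmem := Finset.mem_image_of_mem (fun γ => (q.g γ e', fun ξ : R => q.g γ ξ))
        (Finset.mem_filter.2 ⟨hγ, hγe⟩)
      rw [← h3, Finset.mem_image] at hmem
      obtain ⟨γ₁, hγ₁, h4⟩ := hmem
      rw [Finset.mem_filter] at hγ₁
      rw [Prod.mk.injEq] at h4
      exact ⟨γ₁, hγ₁.1, hγ₁.2, h4.1, fun ξ hξ hξα => congrFun h4.2 ⟨ξ, hpR ξ hξ hξα⟩⟩)
    (fun t ht hte => by
      have h3 := congrArg (fun z => z.2.2.2.1) h
      simp only [isoType] at h3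
      have hmem := Finset.mem_image_of_mem (fun t => (q.c t, q.g (L.lev t) e',
        fun ξ : R => (q.g (L.lev t) ξ, L.code (L.res t ξ)))) ((Finset.mem_filter (p := (e' ≤ L.lev ·))).2 ⟨ht, hte⟩)
      rw [← h3, Finset.mem_image] at hmem
      obtain ⟨s, hs, h4⟩ := hmem
      rw [Finset.mem_filter] at hs
      simp only [Prod.mk.injEq] at h4
      refine ⟨s, hs.1, hs.2, h4.1, h4.2.1, fun ξ hξ hξα => ?_⟩
      have h5 := congrFun h4.2.2 ⟨ξ, hpR ξ hξ hξα⟩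
      simp only [Prod.mk.injEq] at h5
      refine ⟨h5.1, L.code_inj ?_ h5.2⟩
      rw [L.lev_res ((hξα.trans hα).le.trans hs.2), L.lev_res ((hξα.trans hαe).le.trans hte)])
    hne
  exact ⟨r, h1, h2⟩

theorem countable_of_antichain [NoMaxOrder W] (hW : ∀ w : W, (Iic w).Countable)
    (hW1 : #W = Cardinal.aleph 1) (hT : ∀ C : Set T, IsChain (· < ·) C → C.Countable)
    {A : Set (Condition L)} (hA : A.Pairwise fun p q => ¬ ∃ r, p ≤ r ∧ q ≤ r) :
    A.Countable := by
  by_contra hcon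
  obtain ⟨R, B, hBA, hB, hRB, hroot⟩ := exists_root hcon Condition.F
  have hWunc : ¬ (Set.univ : Set W).Countable := by
    rw [← Cardinal.le_aleph0_iff_set_countable, Cardinal.mk_univ, hW1, not_le]
    exact Cardinal.aleph0_lt_aleph_one
  obtain ⟨j⟩ : Nonempty (W ↪ B) := by
    rw [← Cardinal.le_def, hW1, ← Cardinal.succ_aleph0, Order.succ_le_iff, ← not_le,
      Cardinal.le_aleph0_iff_set_countable]
    exact hB
  choose e he using fun α : W => exists_gt α
  have hw : ∀ α, ∃ w, α ≤ w ∧ ∀ x ∈ (j w : Condition L).F, x < e α → x ∈ R := by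
    intro α
    by_contra! h
    have hbad : (⋃ x ∈ {x ∈ Iic (e α) | x ∉ R}, {p ∈ B | x ∈ p.F}).Countable :=
      Set.Countable.biUnion ((hW (e α)).mono fun x hx => hx.1) fun x hx => hroot x hx.2
    have hpre : ((fun w => (j w : Condition L)) ⁻¹'
        (⋃ x ∈ {x ∈ Iic (e α) | x ∉ R}, {p ∈ B | x ∈ p.F})).Countable :=
      hbad.preimage (Subtype.val_injective.comp j.injective)
    apply hWunc
    refine (hpre.union (hW α)).mono fun w _ => ?_
    by_cases hwα : w ≤ α
    · exact Or.inr hwα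
    · obtain ⟨x, hx, hxe, hxR⟩ := h w (not_le.1 hwα).le
      refine Or.inl (Set.mem_biUnion (x := x) ⟨hxe.le, hxR⟩ ⟨(j w).2, hx⟩)
  choose w hw hroot' using hw
  choose q hq hqF using fun α => exists_insert_level (j (w α) : Condition L) (e α)
  have hRq : ∀ α, R ⊆ (q α).F := fun α => (hRB _ (j (w α)).2).trans (le_def.1 (hq α)).1
  have hqR : ∀ α, ∀ x ∈ (q α).F, x ∈ R ∨ e α ≤ x := by
    intro α x hx
    rw [hqF, Finset.mem_insert] at hx
    rcases hx with rfl | hx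
    · exact Or.inr le_rfl
    · rw [or_iff_not_imp_right, not_le]
      exact hroot' α x hx
  have heq : ∀ α, e α ∈ (q α).F := fun α => by
    rw [hqF]
    exact Finset.mem_insert_self _ _
  obtain ⟨k, hk⟩ : ∃ k : W → ℕ, Set.InjOn k R :=
    Set.countable_iff_exists_injOn.1 (Finset.countable_toSet _)
  have hI : ¬ {α | ∀ x ∈ R, x < α}.Countable := by
    intro hc
    have hRc : (⋃ x ∈ R, Iic x).Countable :=
      Set.Countable.biUnion (Finset.countable_toSet R) fun x _ => hW x
    refine hWunc ((hc.union hRc).mono fun α _ => ?_)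
    by_cases h : ∀ x ∈ R, x < α
    · exact Or.inl h
    · push Not at h
      obtain ⟨x, hx, hxα⟩ := h
      exact Or.inr (Set.mem_biUnion (x := x) hx hxα)
  obtain ⟨τ, hτ⟩ := exists_uncountable_fiber_s1 (fun α => isoType R k (e α) (q α)) hI
  let b : W → W := fun α => (insert (w α) (q α).F).max' (Finset.insert_nonempty _ _)
  obtain ⟨α, hα, β, hβ, hlt, hne⟩ := L.exists_res_ne hW hT hτ
    (fun α => (q α).D.filter (e α ≤ L.lev ·)) τ.2.2.2.2
    (fun α hα => congrArg (fun z => z.2.2.2.2) hα.2)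
    (fun α _ t ht => (he α).le.trans (Finset.mem_filter.1 ht).2) b
  have hb : ∀ x ∈ insert (w α) (q α).F, x < β := fun x hx =>
    (Finset.le_max' _ _ hx).trans_lt hlt
  have hwβ : w α < β := hb _ (Finset.mem_insert_self _ _)
  obtain ⟨r, h1, h2⟩ := exists_le_of_isoType_eq hk (hα.2.trans hβ.2.symm) (he α)
    ((hw α).trans_lt (hwβ.trans (he β))) hα.1 (hRq α) (hRq β) (heq α) (heq β) (hqR α) (hqR β)
    (fun x hx => (hb x (Finset.mem_insert_of_mem hx)).trans (he β))
    (fun t ht hte t' ht' hte' => hne t (Finset.mem_filter.2 ⟨ht, hte⟩) t'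
      (Finset.mem_filter.2 ⟨ht', hte'⟩))
  refine hA (hBA (j (w α)).2) (hBA (j (w β)).2) ?_ ⟨r, (hq α).trans h1, (hq β).trans h2⟩
  intro h
  have := j.injective (Subtype.ext h)
  exact (hwβ.trans_le (hw β)).ne this

end Condition

/-- A filter meeting `ℵ₁` many dense subsets of a preorder, from MA(ω₁). -/
theorem MAomega1.exists_filter (hMA : MAomega1.{u}) {P : Type u} [Preorder P] [Nonempty P]
    (hP : ∀ A : Set P, (A.Pairwise fun p q => ¬ ∃ r, p ≤ r ∧ q ≤ r) → A.Countable)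
    {ι : Type u} (hι : #ι ≤ Cardinal.aleph 1) (D : ι → Set P) (hD : ∀ i p, ∃ q ∈ D i, p ≤ q) :
    ∃ G : Set P, (∀ p ∈ G, ∀ q ∈ G, ∃ r ∈ G, p ≤ r ∧ q ≤ r) ∧ ∀ i, ∃ p ∈ G, p ∈ D i := by
  let Q := Antisymmetrization P (· ≤ ·)
  let π : P → Q := toAntisymmetrization (· ≤ ·)
  have hπ : ∀ p q, π p ≤ π q ↔ p ≤ q := fun p q =>
    toAntisymmetrization_le_toAntisymmetrization_iff
  have hs : ∀ x : Q, ∃ p, π p = x := fun x => ⟨ofAntisymmetrization _ x, by simp [π]⟩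
  choose s hs using hs
  have hinj : Function.Injective s := fun x y h => by rw [← hs x, ← hs y, h]
  have hQ : ∀ A : Set Q, (A.Pairwise fun p q => ¬ ∃ r, p ≤ r ∧ q ≤ r) → A.Countable := by
    intro A hA
    refine Set.countable_of_injective_of_countable_image (f := s) hinj.injOn (hP _ ?_)
    rintro _ ⟨x, hx, rfl⟩ _ ⟨y, hy, rfl⟩ hne ⟨r, h1, h2⟩
    refine hA hx hy (fun h => hne (by rw [h])) ⟨π r, ?_, ?_⟩
    · rwa [← hs x, hπ]
    · rwa [← hs y, hπ]
  have hQD : ∀ E ∈ Set.range fun i => {x : Q | ∃ p ∈ D i, p ≤ s x}, ∀ x, ∃ y ∈ E, x ≤ y := by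
    rintro _ ⟨i, rfl⟩ x
    obtain ⟨q, hq, hle⟩ := hD i (s x)
    refine ⟨π q, ⟨q, hq, ?_⟩, ?_⟩
    · rw [← hπ, hs]
    · rwa [← hs x, hπ]
  obtain ⟨G, hG1, hG2, hG3⟩ :=
    hMA Q (Nonempty.map π inferInstance) hQ _ (Cardinal.mk_range_le.trans hι) hQD
  refine ⟨π ⁻¹' G, fun p hp q hq => ?_, fun i => ?_⟩
  · obtain ⟨r, hr, h1, h2⟩ := hG1 _ hp _ hq
    rw [← hs r, hπ] at h1 h2
    exact ⟨s r, by rwa [Set.mem_preimage, hs], h1, h2⟩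
  · obtain ⟨x, hxG, p, hp, hpx⟩ := hG3 _ ⟨i, rfl⟩
    exact ⟨p, hG2 x hxG _ (by rwa [← hs x, hπ]), hp⟩

/-- A coherent system of injections `g γ : Iic γ → ℕ`. -/
structure CoherentSystem (W : Type u) [LinearOrder W] where
  g : W → W → ℕ
  inj : ∀ {γ η ξ : W}, η < ξ → ξ ≤ γ → g γ η ≠ g γ ξ
  coh : ∀ {γ γ' η ξ : W}, η < ξ → ξ ≤ γ → ξ ≤ γ' → g γ ξ = g γ' ξ → g γ η = g γ' η

/-- A generic coherent system of injections, together with the colouring of `T`. -/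
theorem MAomega1.exists_coherent_system (hMA : MAomega1.{u}) {W T : Type u} [LinearOrder W]
    [NoMaxOrder W] [PartialOrder T] (L : Levelling W T) (hW : ∀ w : W, (Iic w).Countable)
    (hW1 : #W = Cardinal.aleph 1) (hT : ∀ C : Set T, IsChain (· < ·) C → C.Countable)
    (hT1 : #T ≤ Cardinal.aleph 1) :
    ∃ (C : CoherentSystem W) (c : T → ℕ),
      ∀ t t', L.lev t ≠ L.lev t' → c t = c t' → ∃ ξ, ξ ≤ L.lev t ∧ ξ ≤ L.lev t' ∧
        C.g (L.lev t) ξ = C.g (L.lev t') ξ ∧ L.res t ξ ≠ L.res t' ξ := by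
  have : Nonempty (Condition L) := ⟨⟨∅, fun _ _ => 0, ∅, fun _ => 0, by simp, by simp, by simp,
    by simp⟩⟩
  obtain ⟨G, hG, hGD⟩ := hMA.exists_filter (P := Condition L) (ι := W ⊕ T)
    (fun A => Condition.countable_of_antichain hW hW1 hT)
    (by
      rw [Cardinal.mk_sum, Cardinal.lift_id, Cardinal.lift_id, hW1]
      exact (add_le_add_right hT1 _).trans
        (Cardinal.add_eq_self (Cardinal.aleph0_le_aleph 1)).le)
    (Sum.elim (fun w => {p | w ∈ p.F}) fun t => {p | t ∈ p.D})
    (by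
      rintro (w | t) p
      · obtain ⟨q, hq, hqF⟩ := p.exists_insert_level w
        exact ⟨q, by simp [hqF], hq⟩
      · obtain ⟨q, hq, hqF⟩ := p.exists_insert_level (L.lev t)
        obtain ⟨r, hr, hrt⟩ := q.exists_insert_color t (by simp [hqF])
        exact ⟨r, hrt, hq.trans hr⟩)
  have hF : ∀ w, ∃ p ∈ G, w ∈ p.F := fun w => hGD (Sum.inl w)
  have hD : ∀ t, ∃ p ∈ G, t ∈ p.D := fun t => hGD (Sum.inr t)
  have hF2 : ∀ v w, ∃ p ∈ G, v ∈ p.F ∧ w ∈ p.F := fun v w => by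
    obtain ⟨p, hp, hv⟩ := hF v
    obtain ⟨q, hq, hw⟩ := hF w
    obtain ⟨r, hr, hpr, hqr⟩ := hG p hp q hq
    exact ⟨r, hr, hpr.1 hv, hqr.1 hw⟩
  have hF4 : ∀ u v w x, ∃ p ∈ G, (u ∈ p.F ∧ v ∈ p.F) ∧ w ∈ p.F ∧ x ∈ p.F := fun u v w x => by
    obtain ⟨p, hp, hv⟩ := hF2 u v
    obtain ⟨q, hq, hw⟩ := hF2 w x
    obtain ⟨r, hr, hpr, hqr⟩ := hG p hp q hq
    exact ⟨r, hr, ⟨hpr.1 hv.1, hpr.1 hv.2⟩, hqr.1 hw.1, hqr.1 hw.2⟩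
  choose P hPG hP using hF2
  choose Q hQG hQ using hD
  have hg : ∀ p ∈ G, ∀ γ ∈ p.F, ∀ ξ ∈ p.F, ξ ≤ γ → (P γ ξ).g γ ξ = p.g γ ξ :=
    fun p hp γ hγ ξ hξ hle => by
      obtain ⟨r, -, h1, h2⟩ := hG p hp _ (hPG γ ξ)
      rw [← h1.2.2.1 γ hγ ξ hξ hle, h2.2.2.1 γ (hP γ ξ).1 ξ (hP γ ξ).2 hle]
  have hc : ∀ p ∈ G, ∀ t ∈ p.D, (Q t).c t = p.c t := fun p hp t ht => by
    obtain ⟨r, -, h1, h2⟩ := hG p hp _ (hQG t)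
    rw [← h1.2.2.2 t ht, h2.2.2.2 t (hQ t)]
  refine ⟨⟨fun γ ξ => (P γ ξ).g γ ξ, ?_, ?_⟩, fun t => (Q t).c t, ?_⟩
  · intro γ η ξ hlt hle
    obtain ⟨p, hp, ⟨h1, h2⟩, h3, -⟩ := hF4 γ η ξ ξ
    simp only [hg p hp γ h1 η h2 (hlt.le.trans hle), hg p hp γ h1 ξ h3 hle]
    exact p.inj γ h1 η h2 ξ h3 hlt hle
  · intro γ γ' η ξ hlt hle hle'
    obtain ⟨p, hp, ⟨h1, h2⟩, h3, h4⟩ := hF4 γ γ' η ξ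
    simp only [hg p hp γ h1 η h3 (hlt.le.trans hle), hg p hp γ h1 ξ h4 hle,
      hg p hp γ' h2 η h3 (hlt.le.trans hle'), hg p hp γ' h2 ξ h4 hle']
    exact p.coh γ h1 γ' h2 η h3 ξ h4 hlt hle hle'
  · intro t t' hlev heq
    obtain ⟨p, hp, h1, h2⟩ := hG _ (hQG t) _ (hQG t')
    have ht := h1.2.1 (hQ t)
    have ht' := h2.2.1 (hQ t')
    simp only [hc p hp t ht, hc p hp t' ht'] at heq
    obtain ⟨ξ, k1, k2, k3, k4, k5⟩ := p.col t ht t' ht' hlev heq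
    refine ⟨ξ, k2, k3, ?_, k5⟩
    simp only [hg p hp _ (p.lev_mem t ht) ξ k1 k2, hg p hp _ (p.lev_mem t' ht') ξ k1 k3, k4]

namespace IsTree

variable {T : Type u} [PartialOrder T]

theorem treeHeight_eq (hT : IsTree T) {x : T} {α : Type u} (r : α → α → Prop) [IsWellOrder α r]
    (e : (fun a b : {y : T // y < x} => (a : T) < (b : T)) ≃r r) :
    treeHeight x = Ordinal.type r := by
  have := hT x
  rw [treeHeight, dif_pos this]
  exact e.ordinalType_congr

theorem treeHeight_eq_typein_s1 (hT : IsTree T) {x t : T} (h : x < t) :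
    haveI := hT t
    treeHeight x =
      Ordinal.typein (fun a b : {y : T // y < t} => (a : T) < (b : T)) ⟨x, h⟩ := by
  have := hT t
  rw [← Ordinal.type_subrel]
  refine hT.treeHeight_eq _ ⟨⟨fun y => ⟨⟨y, y.2.trans h⟩, y.2⟩, fun y => ⟨y.1.1, y.2⟩,
    fun _ => rfl, fun _ => rfl⟩, Iff.rfl⟩

theorem treeHeight_eq_type_s1 (hT : IsTree T) (t : T) :
    haveI := hT t
    treeHeight t = Ordinal.type (fun a b : {y : T // y < t} => (a : T) < (b : T)) := by
  have := hT t
  exact hT.treeHeight_eq _ (RelIso.refl _)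

theorem treeHeight_lt (hT : IsTree T) {x t : T} (h : x < t) : treeHeight x < treeHeight t := by
  have := hT t
  rw [hT.treeHeight_eq_typein_s1 h, hT.treeHeight_eq_type_s1 t]
  exact Ordinal.typein_lt_type _ _

theorem exists_le_treeHeight_eq (hT : IsTree T) {t : T} {α : Ordinal.{u}}
    (h : α ≤ treeHeight t) : ∃ x ≤ t, treeHeight x = α := by
  have := hT t
  rcases h.eq_or_lt with rfl | h
  · exact ⟨t, le_rfl, rfl⟩
  · rw [hT.treeHeight_eq_type_s1 t, ← Ordinal.mem_range_typein_iff] at h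
    obtain ⟨⟨x, hx⟩, rfl⟩ := h
    exact ⟨x, hx.le, hT.treeHeight_eq_typein_s1 hx⟩

theorem total_below (hT : IsTree T) {u v t : T} (hu : u ≤ t) (hv : v ≤ t) : u ≤ v ∨ v ≤ u := by
  rcases hu.eq_or_lt with rfl | hu
  · exact Or.inr hv
  rcases hv.eq_or_lt with rfl | hv
  · exact Or.inl hu.le
  have := hT t
  rcases trichotomous_of (fun a b : {y : T // y < t} => (a : T) < (b : T)) ⟨u, hu⟩ ⟨v, hv⟩
    with h | h | h
  · exact Or.inl (le_of_lt h)
  · exact Or.inl (congrArg Subtype.val h).le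
  · exact Or.inr (le_of_lt h)

end IsTree

/-- The index set of the levels of an Aronszajn tree. -/
abbrev LevelIndex : Type u := omega1.{u}.ToType

theorem mk_levelIndex : #LevelIndex.{u} = Cardinal.aleph 1 := Cardinal.mk_ord_toType _

theorem countable_Iic_levelIndex (w : LevelIndex.{u}) : (Iic w).Countable := by
  have h : (Iio w).Countable := by
    rw [← Cardinal.le_aleph0_iff_set_countable, ← Order.lt_succ_iff, Cardinal.succ_aleph0]
    rw [← mk_levelIndex.{u}]
    exact Cardinal.mk_Iio_lt w (by rw [mk_levelIndex, Ordinal.type_toType, omega1])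
  rw [← Set.Iio_insert]
  exact h.insert w

instance : NoMaxOrder LevelIndex.{u} where
  exists_gt a := by
    by_contra! h
    have huniv : (Set.univ : Set LevelIndex.{u}).Countable :=
      (countable_Iic_levelIndex a).mono fun b _ => h b
    rw [← Cardinal.le_aleph0_iff_set_countable, Cardinal.mk_univ, mk_levelIndex] at huniv
    exact Cardinal.aleph0_lt_aleph_one.not_ge huniv

namespace IsAronszajn

variable {T : Type u} [PartialOrder T]

/-- An enumeration of the `α`-th level of an Aronszajn tree. -/
noncomputable def levelCode (hT : IsAronszajn T) (α : Ordinal.{u}) : T → ℕ :=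
  (Set.countable_iff_exists_injOn.1 (hT.2.2.1 α)).choose

theorem levelCode_injOn (hT : IsAronszajn T) (α : Ordinal.{u}) :
    Set.InjOn (hT.levelCode α) {x : T | treeHeight x = α} :=
  (Set.countable_iff_exists_injOn.1 (hT.2.2.1 α)).choose_spec

/-- The levelling of an Aronszajn tree given by the height function. -/
noncomputable def levelling (hT : IsAronszajn T) : Levelling LevelIndex.{u} T where
  lev t := ToType.mk ⟨treeHeight t, hT.2.1.2 t⟩
  res t ξ := if h : (ξ.toOrd : Ordinal) ≤ treeHeight t then
    (hT.1.exists_le_treeHeight_eq h).choose else t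
  code t := hT.levelCode (treeHeight t) t
  lev_strictMono h := by
    rw [OrderIso.lt_iff_lt]
    exact hT.1.treeHeight_lt h
  res_le {t ξ} h := by
    rw [← OrderIso.symm_apply_le] at h
    rw [dif_pos (show (ξ.toOrd : Ordinal) ≤ treeHeight t from h)]
    exact (hT.1.exists_le_treeHeight_eq h).choose_spec.1
  lev_res {t ξ} h := by
    rw [← OrderIso.symm_apply_le] at h
    rw [← OrderIso.eq_symm_apply, Subtype.ext_iff,
      dif_pos (show (ξ.toOrd : Ordinal) ≤ treeHeight t from h)]
    exact (hT.1.exists_le_treeHeight_eq h).choose_spec.2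
  total_below := hT.1.total_below
  code_inj {t t'} h hc := by
    have h' : treeHeight t = treeHeight t' := congrArg Subtype.val (ToType.mk.injective h)
    rw [← h'] at hc
    exact hT.levelCode_injOn _ rfl h'.symm hc

theorem mk_le (hT : IsAronszajn T) : #T ≤ Cardinal.aleph 1 := by
  have hinj : Function.Injective fun t => (hT.levelling.lev t, hT.levelling.code t) := by
    intro t t' h
    rw [Prod.mk.injEq] at h
    exact hT.levelling.code_inj h.1 h.2
  refine (Cardinal.mk_le_of_injective
    (f := fun t => (hT.levelling.lev t, ULift.up.{u} (hT.levelling.code t)))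
    fun t t' h => hinj (by simpa using h)).trans ?_
  rw [Cardinal.mk_prod, Cardinal.lift_id, Cardinal.lift_id, mk_levelIndex, Cardinal.mk_uLift,
    Cardinal.mk_nat, Cardinal.lift_aleph0]
  exact Cardinal.mul_le_of_le (Cardinal.aleph0_le_aleph 1) le_rfl (Cardinal.aleph0_le_aleph 1)

end IsAronszajn

namespace CoherentSystem

variable {W : Type u} [LinearOrder W] (C : CoherentSystem W)

/-- The tree of restrictions of the members of a coherent system: the pair `(ξ, n)` stands for
the common restriction to `Iic ξ` of all `C.g γ` such that `C.g γ ξ = n`. -/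
def Tree : Type u := {x : W × ℕ // ∃ γ, x.1 ≤ γ ∧ C.g γ x.1 = x.2}

variable {C}

theorem eq_of_le {γ γ' η ξ : W} (h : η ≤ ξ) (hγ : ξ ≤ γ) (hγ' : ξ ≤ γ')
    (heq : C.g γ ξ = C.g γ' ξ) : C.g γ η = C.g γ' η := by
  rcases h.eq_or_lt with rfl | h
  · exact heq
  · exact C.coh h hγ hγ' heq

instance : PartialOrder C.Tree where
  le x y := x.1.1 ≤ y.1.1 ∧ ∃ γ, y.1.1 ≤ γ ∧ C.g γ x.1.1 = x.1.2 ∧ C.g γ y.1.1 = y.1.2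
  le_refl x := ⟨le_rfl, x.2.imp fun _ h => ⟨h.1, h.2, h.2⟩⟩
  le_trans := by
    rintro x y z ⟨hxy, γ, h1, h2, h3⟩ ⟨hyz, γ', k1, k2, k3⟩
    refine ⟨hxy.trans hyz, γ', k1, ?_, k3⟩
    rw [← h2]
    exact eq_of_le hxy (hyz.trans k1) h1 (k2.trans h3.symm)
  le_antisymm := by
    rintro x y ⟨hxy, γ, h1, h2, h3⟩ ⟨hyx, -⟩
    have h := le_antisymm hxy hyx
    refine Subtype.ext (Prod.ext h ?_)
    rw [← h2, ← h3, h]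

/-- The restriction of `C.g γ` to `Iic ξ`, as a node of the tree. -/
def node (C : CoherentSystem W) (γ ξ : W) (h : ξ ≤ γ) : C.Tree := ⟨(ξ, C.g γ ξ), γ, h, rfl⟩

theorem node_le (γ ξ : W) (h : ξ ≤ γ) : C.node γ ξ h ≤ C.node γ γ le_rfl :=
  ⟨h, γ, le_rfl, rfl, rfl⟩

theorem eq_of_le_of_fst_eq {x y : C.Tree} (h : x ≤ y) (h1 : x.1.1 = y.1.1) : x = y := by
  obtain ⟨-, γ, -, h2, h3⟩ := h
  refine Subtype.ext (Prod.ext h1 ?_)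
  rw [← h2, ← h3, h1]

theorem fst_lt {x y : C.Tree} (h : x < y) : x.1.1 < y.1.1 :=
  lt_of_le_of_ne h.le.1 fun h1 => h.ne (eq_of_le_of_fst_eq h.le h1)

theorem snd_ne {x y : C.Tree} (h : x < y) : x.1.2 ≠ y.1.2 := by
  obtain ⟨-, γ, h1, h2, h3⟩ := h.le
  rw [← h2, ← h3]
  exact C.inj (fst_lt h) h1

/-- The predecessors of a node correspond to the smaller levels. -/
noncomputable def belowIso (x : C.Tree) : (fun a b : {y : C.Tree // y < x} => (a : C.Tree) < b) ≃r
    (Subrel (α := W) (· < ·) (· < x.1.1)) where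
  toFun y := ⟨y.1.1.1, fst_lt y.2⟩
  invFun ξ := ⟨⟨(ξ, C.g x.2.choose ξ), x.2.choose, ξ.2.le.trans x.2.choose_spec.1, rfl⟩,
    lt_of_le_of_ne ⟨ξ.2.le, x.2.choose, x.2.choose_spec.1, rfl, x.2.choose_spec.2⟩
      fun h => (ξ.2 : (ξ : W) < x.1.1).ne (congrArg (fun y : C.Tree => y.1.1) h)⟩
  left_inv y := by
    obtain ⟨h1, γ, h2, h3, h4⟩ := y.2.le
    refine Subtype.ext (Subtype.ext (Prod.ext rfl ?_))
    change C.g _ y.1.1.1 = y.1.1.2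
    rw [← h3]
    exact eq_of_le h1 x.2.choose_spec.1 h2 (x.2.choose_spec.2.trans h4.symm)
  right_inv ξ := rfl
  map_rel_iff' {y z} := by
    refine ⟨fun h => ?_, fun h => fst_lt h⟩
    have h : y.1.1.1 < z.1.1.1 := h
    obtain ⟨h1, γ, h2, h3, h4⟩ := y.2.le
    obtain ⟨k1, γ', k2, k3, k4⟩ := z.2.le
    refine lt_of_le_of_ne ⟨h.le, γ', k1.trans k2, ?_, k3⟩ fun h' => h.ne (by rw [h'])
    rw [← h3]
    exact eq_of_le h1 k2 h2 (k4.trans h4.symm)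

variable [WellFoundedLT W]

theorem isTree : IsTree C.Tree := fun x => (belowIso x).toRelEmbedding.isWellOrder

theorem treeHeight_eq (x : C.Tree) :
    treeHeight x = Ordinal.typein (α := W) (· < ·) x.1.1 := by
  rw [← Ordinal.type_subrel]
  exact isTree.treeHeight_eq _ (belowIso x)

theorem isAronszajn (C : CoherentSystem LevelIndex.{u}) : IsAronszajn C.Tree := by
  refine ⟨isTree, ⟨fun α hα => ?_, fun x => ?_⟩, fun α => ?_, fun K hK => ?_⟩
  · refine ⟨C.node (ToType.mk ⟨α, hα⟩) _ le_rfl, ?_⟩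
    rw [treeHeight_eq]
    exact congrArg Subtype.val (ToType.mk.symm_apply_apply (⟨α, hα⟩ : Iio omega1.{u}))
  · rw [treeHeight_eq]
    exact Ordinal.typein_lt_self _
  · refine Set.countable_iff_exists_injOn.2 ⟨fun x => x.1.2, fun x hx y hy h => ?_⟩
    rw [Set.mem_ofPred_eq, treeHeight_eq] at hx hy
    exact Subtype.ext (Prod.ext (Ordinal.typein_injective _ (hx.trans hy.symm)) h)
  · refine Set.countable_iff_exists_injOn.2 ⟨fun x => x.1.2, fun x hx y hy h => ?_⟩
    by_contra hne
    rcases hK hx hy hne with h' | h'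
    · exact snd_ne h' h
    · exact snd_ne h' h.symm

end CoherentSystem

theorem IsWeakEmbedding.treeHeight_le {S T : Type u} [PartialOrder S] [PartialOrder T]
    (hS : IsTree S) (hT : IsTree T) {f : S → T} (hf : IsWeakEmbedding f) (x : S) :
    treeHeight x ≤ treeHeight (f x) := by
  have hSx := hS x
  have hTx := hT (f x)
  rw [hS.treeHeight_eq_type_s1 x, hT.treeHeight_eq_type_s1 (f x)]
  exact Ordinal.type_le_iff'.2 ⟨RelEmbedding.ofMonotone (fun y => ⟨f y, hf _ _ y.2⟩)
    fun a b h => hf _ _ h⟩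

/-- Under MA(ω₁) there is no Aronszajn tree which is universal for
Aronszajn trees under weak embeddings. -/
theorem no_universal_Aronszajn (hMA : MAomega1.{u}) :
    ∀ (T : Type u) [PartialOrder T], IsAronszajn T →
      ¬ ∀ (S : Type u) [PartialOrder S], IsAronszajn S →
        ∃ f : S → T, IsWeakEmbedding f := by
  intro T _ hT huniv
  set L := hT.levelling
  obtain ⟨C, c, hc⟩ := hMA.exists_coherent_system L countable_Iic_levelIndex mk_levelIndex
    hT.2.2.2 hT.mk_le
  obtain ⟨f, hf⟩ := huniv C.Tree C.isAronszajn
  have hlev : ∀ x : C.Tree, x.1.1 ≤ L.lev (f x) := fun x => by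
    have h := hf.treeHeight_le CoherentSystem.isTree hT.1 x
    rw [CoherentSystem.treeHeight_eq] at h
    exact ToType.mk.symm_apply_le.1 h
  let s : LevelIndex.{u} → C.Tree := fun α => C.node α α le_rfl
  let t : LevelIndex.{u} → T := fun α => L.res (f (s α)) α
  have ht : ∀ α, L.lev (t α) = α := fun α => L.lev_res (hlev (s α))
  obtain ⟨α, β, hne, heq⟩ : ∃ α β, α ≠ β ∧ c (t α) = c (t β) := by
    by_contra! h
    have hinj : Function.Injective fun α => c (t α) := fun α β h' => by
      by_contra hne
      exact h α β hne h'
    have := hinj.countable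
    rw [← Cardinal.mk_le_aleph0_iff, mk_levelIndex] at this
    exact Cardinal.aleph0_lt_aleph_one.not_ge this
  obtain ⟨ξ, h1, h2, h3, h4⟩ := hc (t α) (t β) (by rwa [ht, ht]) heq
  rw [ht] at h1 h2
  rw [ht, ht] at h3
  have hmono : ∀ {x y : C.Tree}, x ≤ y → f x ≤ f y := fun h => by
    rcases h.eq_or_lt with rfl | h
    · exact le_rfl
    · exact (hf _ _ h).le
  have hres : ∀ γ (h : ξ ≤ γ), L.res (t γ) ξ = L.res (f (C.node γ ξ h)) ξ := fun γ h => by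
    refine L.eq_of_le_of_lev_eq (t := f (s γ)) ?_ ?_ ?_
    · exact (L.res_le (by rwa [ht])).trans (L.res_le (hlev (s γ)))
    · exact (L.res_le (hlev (C.node γ ξ h))).trans (hmono (CoherentSystem.node_le γ ξ h))
    · exact (L.lev_res (by rwa [ht])).trans (L.lev_res (hlev (C.node γ ξ h))).symm
  have hnode : C.node α ξ h1 = C.node β ξ h2 := Subtype.ext (Prod.ext rfl h3)
  exact h4 (by rw [hres α h1, hres β h2, hnode])
end
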